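/- arXiv:1107.4754 — 2 statements merged into one kernel-verified Lean document; each statement's English description precedes it below -/
import Mathlib

section
/- Assume the weight sequence b satisfies conditions (M1) and (M2). Then, as α → 0⁺, ℬ_b(e^{−α}) = h(ρ+1) α^{−ρ−2} + D(0) α^{−2} + O(α^{C₀−2}), where h = A Γ(ρ+1) ζ(ρ+1) and D(0) is the value at s = 0 of the analytic continuation of D; moreover the third derivative satisfies F_b′′′(e^{−α}) = O(α^{−ρ−3}) as α → 0⁺. -/
open Filter Topology Asymptotics MeasureTheory Real

noncomputable section

/-- `F_b(x) = -∑_{k≥1} b_k log(1 - x^k)` (so that `f_b = exp F_b`). -/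
def Fb (b : ℕ → ℝ) (x : ℝ) : ℝ := -∑' k : ℕ, b (k + 1) * Real.log (1 - x ^ (k + 1))

/-- Complex version of `log f_b` (principal branch). -/
def FbC (b : ℕ → ℝ) (x : ℂ) : ℂ := -∑' k : ℕ, (b (k + 1) : ℂ) * Complex.log (1 - x ^ (k + 1))

/-- `f_b(x) = ∏_{k≥1} (1 - x^k)^{-b_k}`. -/
def fb (b : ℕ → ℝ) (x : ℝ) : ℝ := Real.exp (Fb b x)

/-- Complex version of `f_b`. -/
def fbC (b : ℕ → ℝ) (x : ℂ) : ℂ := Complex.exp (FbC b x)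

/-- `F_{m,b}(x) = -∑_{k=1}^m b_k log(1 - x^k)`. -/
def Fmb (b : ℕ → ℝ) (m : ℕ) (x : ℝ) : ℝ := -∑ k ∈ Finset.Icc 1 m, b k * Real.log (1 - x ^ k)

/-- `f_{m,b}(x) = ∏_{k=1}^m (1 - x^k)^{-b_k}`. -/
def fmb (b : ℕ → ℝ) (m : ℕ) (x : ℝ) : ℝ := Real.exp (Fmb b m x)

/-- `𝒜_b(r) = r F_b'(r)`. -/
def Abf (b : ℕ → ℝ) (r : ℝ) : ℝ := r * deriv (Fb b) r

/-- `ℬ_b(r) = r² F_b''(r) + r F_b'(r)`. -/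
def Bbf (b : ℕ → ℝ) (r : ℝ) : ℝ :=
  r ^ 2 * iteratedDeriv 2 (Fb b) r + r * deriv (Fb b) r

/-- Meinardus condition (M1): the Dirichlet series `D(s) = ∑_{k≥1} b_k k^{-s}` converges for
`Re s > ρ` and `Dc` is its analytic continuation to `{Re s ≥ -C₀}`, analytic there except for a
simple pole at `s = ρ` with residue `A > 0`. -/
def M1 (b : ℕ → ℝ) (ρ C₀ A : ℝ) (Dc : ℂ → ℂ) : Prop :=
  0 < ρ ∧ 0 < C₀ ∧ C₀ < 1 ∧ 0 < A ∧
  (∀ s : ℂ, ρ < s.re →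
    HasSum (fun k : ℕ => (b (k + 1) : ℂ) * ((k + 1 : ℕ) : ℂ) ^ (-s)) (Dc s)) ∧
  (∀ s : ℂ, -C₀ ≤ s.re → s ≠ (ρ : ℂ) → DifferentiableAt ℂ Dc s) ∧
  (∃ φ : ℂ → ℂ, (∀ s : ℂ, -C₀ ≤ s.re → DifferentiableAt ℂ φ s) ∧
    ∀ s : ℂ, -C₀ ≤ s.re → s ≠ (ρ : ℂ) → Dc s = (A : ℂ) / (s - (ρ : ℂ)) + φ s)

/-- Meinardus condition (M2): the continuation `Dc` is of finite order `C₁` in `{Re s ≥ -C₀}`,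
i.e. `Dc s = O(|Im s|^{C₁})` as `|Im s| → ∞`, uniformly in `Re s ≥ -C₀`. -/
def M2 (C₀ C₁ : ℝ) (Dc : ℂ → ℂ) : Prop :=
  0 < C₁ ∧ ∃ K y₀ : ℝ, ∀ s : ℂ, -C₀ ≤ s.re → y₀ ≤ |s.im| → ‖Dc s‖ ≤ K * |s.im| ^ C₁

/-- Meinardus condition (M3): `∑_{k≥1} b_k e^{-kα} sin²(πku) ≥ C₂ α^{-ε}` for all small `α > 0`
and all `u` with `α/(2π) < |u| ≤ 1/2`. -/
def M3 (b : ℕ → ℝ) : Prop :=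
  ∃ ε C₂ : ℝ, 0 < ε ∧ 0 < C₂ ∧ ∃ α₀ : ℝ, 0 < α₀ ∧ ∀ α : ℝ, 0 < α → α ≤ α₀ →
    ∀ u : ℝ, α / (2 * π) < |u| → |u| ≤ 1 / 2 →
      C₂ * α ^ (-ε) ≤
        ∑' k : ℕ, b (k + 1) * Real.exp (-((k : ℝ) + 1) * α) * Real.sin (π * ((k : ℝ) + 1) * u) ^ 2

/-- `h = A Γ(ρ+1) ζ(ρ+1)`. -/
def hMein (ρ A : ℝ) : ℝ := A * Real.Gamma (ρ + 1) * (riemannZeta ((ρ : ℂ) + 1)).re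

/-- The normalizing constant `a(n) = (A Γ(ρ+1) ζ(ρ+1) / n)^{1/(ρ+1)}`. -/
def aM (ρ A : ℝ) (n : ℕ) : ℝ := (hMein ρ A / n) ^ ((1 : ℝ) / (ρ + 1))


/-! ### Bounds on vertical strips -/

lemma mellin_bdd_strip {f : ℝ → ℂ} {a b : ℝ} (ha : MellinConvergent f a)
    (hb : MellinConvergent f b) :
    ∃ K : ℝ, ∀ s : ℂ, a ≤ s.re → s.re ≤ b → ‖mellin f s‖ ≤ K := by
  refine ⟨(∫ t in Set.Ioi (0 : ℝ), ‖(t : ℂ) ^ ((a : ℂ) - 1) • f t‖) +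
    ∫ t in Set.Ioi (0 : ℝ), ‖(t : ℂ) ^ ((b : ℂ) - 1) • f t‖, fun s h1 h2 => ?_⟩
  rw [← integral_add ha.norm hb.norm]
  refine norm_integral_le_of_norm_le (ha.norm.add hb.norm) ?_
  refine (ae_restrict_iff' measurableSet_Ioi).2 (Eventually.of_forall fun t ht => ?_)
  have ht' : (0 : ℝ) < t := ht
  simp only [norm_smul, Complex.norm_cpow_eq_rpow_re_of_pos ht', Complex.sub_re, Complex.one_re,
    Complex.ofReal_re, ← add_mul]
  refine mul_le_mul_of_nonneg_right ?_ (norm_nonneg _)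
  rcases le_total t 1 with h | h
  · exact (Real.rpow_le_rpow_of_exponent_ge ht' h (by linarith)).trans
      (le_add_of_nonneg_right (Real.rpow_nonneg ht'.le _))
  · exact (Real.rpow_le_rpow_of_exponent_le h (by linarith)).trans
      (le_add_of_nonneg_left (Real.rpow_nonneg ht'.le _))

lemma Gamma_decay (n : ℕ) : ∀ a b : ℝ, 0 < a → ∃ K : ℝ, ∀ s : ℂ, a ≤ s.re → s.re ≤ b →
    ‖Complex.Gamma s‖ * |s.im| ^ n ≤ K := by
  induction n with
  | zero =>
    intro a b ha
    have hconv : ∀ c : ℝ, 0 < c → MellinConvergent (fun x => ((Real.exp (-x) : ℝ) : ℂ)) (c : ℂ) := by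
      intro c hc
      have := Complex.GammaIntegral_convergent (s := (c : ℂ)) (by simpa using hc)
      refine this.congr_fun (fun t _ => ?_) measurableSet_Ioi
      simp [mul_comm]
    by_cases hab : a ≤ b
    · obtain ⟨K, hK⟩ := mellin_bdd_strip (hconv a ha) (hconv b (by linarith))
      refine ⟨K, fun s h1 h2 => ?_⟩
      rw [pow_zero, mul_one, Complex.Gamma_eq_integral (by linarith), Complex.GammaIntegral_eq_mellin]
      exact hK s h1 h2
    · exact ⟨0, fun s h1 h2 => by linarith⟩
  | succ n ih =>
    intro a b ha
    obtain ⟨K, hK⟩ := ih (a + 1) (b + 1) (by linarith)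
    refine ⟨K, fun s h1 h2 => ?_⟩
    have hs : s ≠ 0 := by
      rintro rfl; simp at h1; linarith
    have := hK (s + 1) (by simpa using h1) (by simpa using h2)
    rw [Complex.Gamma_add_one s hs, norm_mul] at this
    simp only [Complex.add_im, Complex.one_im, add_zero] at this
    refine le_trans ?_ this
    have h3 := Complex.abs_im_le_norm s
    calc ‖Complex.Gamma s‖ * |s.im| ^ (n+1) = |s.im| * ‖Complex.Gamma s‖ * |s.im| ^ n := by ring
      _ ≤ _ := by gcongr

lemma completedZeta₀_bdd_strip (a b : ℝ) :
    ∃ K : ℝ, ∀ s : ℂ, a ≤ s.re → s.re ≤ b → ‖completedRiemannZeta₀ s‖ ≤ K := by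
  have hP := (HurwitzZeta.hurwitzEvenFEPair 0).isStrongFEPair_toStrongFEPair
  have hconv : ∀ c : ℝ, MellinConvergent (HurwitzZeta.hurwitzEvenFEPair 0).f_modif (c : ℂ) := by
    intro c
    exact mellinConvergent_of_isBigO_rpow (HurwitzZeta.hurwitzEvenFEPair 0).hf_modif_int
      (hP.hf_top _) (a := c + 1) (by simp) (hP.hf_zero _) (b := c - 1) (by simp)
  obtain ⟨K, hK⟩ := mellin_bdd_strip (hconv (a / 2)) (hconv (b / 2))
  refine ⟨K / 2, fun s h1 h2 => ?_⟩
  have : completedRiemannZeta₀ s =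
    mellin (HurwitzZeta.hurwitzEvenFEPair 0).f_modif (s / 2) / 2 := rfl
  rw [this, norm_div, Complex.norm_ofNat]
  have := hK (s / 2) (by simp; linarith) (by simp; linarith)
  linarith

lemma Gamma_mul_zeta_eq {s : ℂ} (hs : 1 < s.re) : Complex.Gamma s * riemannZeta (s - 1) =
    2 ^ (s - 1) / (√π : ℂ) * (π : ℂ) ^ ((s - 1) / 2) * ((s - 1) / 2) * Complex.Gamma (s / 2) *
      completedRiemannZeta (s - 1) := by
  have hs1 : s - 1 ≠ 0 := by
    intro h
    have := congrArg Complex.re h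
    simp at this; linarith
  have hG : Complex.Gamma ((s - 1) / 2) ≠ 0 := by
    apply Complex.Gamma_ne_zero_of_re_pos
    simp; linarith
  rw [riemannZeta_def_of_ne_zero hs1, Complex.Gammaℝ_def]
  have hd := Complex.Gamma_mul_Gamma_add_half (s / 2)
  have h2 : s / 2 + 1 / 2 = (s - 1) / 2 + 1 := by ring
  rw [h2, Complex.Gamma_add_one _ (div_ne_zero hs1 two_ne_zero), mul_div_cancel₀ s (two_ne_zero' ℂ)] at hd
  have hpi : (√π : ℂ) ≠ 0 := by
    exact_mod_cast (Real.sqrt_pos.2 Real.pi_pos).ne'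
  have e1 : (2 : ℂ) ^ (s - 1) * 2 ^ (1 - s) = 1 := by
    rw [← Complex.cpow_add _ _ two_ne_zero]; simp
  have hpi' : (π : ℂ) ≠ 0 := by exact_mod_cast Real.pi_pos.ne'
  have e2 : (π : ℂ) ^ (-(s - 1) / 2) * (π : ℂ) ^ ((s - 1) / 2) = 1 := by
    rw [← Complex.cpow_add _ _ hpi']; ring_nf; simp
  have e3 : (π : ℂ) ^ ((s - 1) / 2) ≠ 0 := right_ne_zero_of_mul_eq_one e2
  have hGs : Complex.Gamma s = 2 ^ (s - 1) / (√π : ℂ) * (Complex.Gamma (s / 2) * ((s - 1) / 2 * Complex.Gamma ((s - 1) / 2))) := by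
    rw [hd]; field_simp; linear_combination (-Complex.Gamma s) * e1
  rw [hGs, eq_inv_of_mul_eq_one_left e2]
  generalize (π : ℂ) ^ ((s - 1) / 2) = P at *
  generalize (2 : ℂ) ^ (s - 1) = Q at *
  generalize completedRiemannZeta (s - 1) = R at *
  field_simp

lemma Gamma_zeta_decay (n : ℕ) {a b : ℝ} (ha : 1 < a) : ∃ K : ℝ, ∀ s : ℂ, a ≤ s.re → s.re ≤ b →
    1 ≤ |s.im| → ‖Complex.Gamma s * riemannZeta (s - 1)‖ * |s.im| ^ n ≤ K := by
  obtain ⟨K1, hK1⟩ := Gamma_decay (n + 1) (a / 2) (b / 2) (by linarith)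
  obtain ⟨K2, hK2⟩ := completedZeta₀_bdd_strip (a - 1) (b - 1)
  refine ⟨(2 ^ (b - 1) / √π * π ^ ((b - 1) / 2) * ((|b| + 1 + 1) / 2)) * (2 ^ (n + 1) * K1) * (K2 + 1 + 1), fun s h1 h2 h3 => ?_⟩
  rw [Gamma_mul_zeta_eq (by linarith), completedRiemannZeta_eq]
  have hK1s := hK1 (s / 2) (by simp; linarith) (by simp; linarith)
  have hK2s := hK2 (s - 1) (by simp; linarith) (by simp; linarith)
  have hb1 : ‖(1 : ℂ) / (s - 1)‖ ≤ 1 := by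
    rw [norm_div, norm_one]
    refine div_le_one_of_le₀ ?_ (norm_nonneg _)
    have := Complex.abs_im_le_norm (s - 1)
    simp at this; linarith
  have hb2 : ‖(1 : ℂ) / (1 - (s - 1))‖ ≤ 1 := by
    rw [norm_div, norm_one]
    refine div_le_one_of_le₀ ?_ (norm_nonneg _)
    have := Complex.abs_im_le_norm (1 - (s - 1))
    simp at this; linarith
  have hL : ‖completedRiemannZeta₀ (s - 1) - 1 / (s - 1) - 1 / (1 - (s - 1))‖ ≤ K2 + 1 + 1 := by
    refine (norm_sub_le _ _).trans (add_le_add ((norm_sub_le _ _).trans (add_le_add hK2s hb1)) hb2)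
  have hs1 : ‖(s - 1) / 2‖ ≤ (|b| + 1 + 1) / 2 * |s.im| := by
    rw [norm_div, Complex.norm_ofNat]
    have h4 := Complex.norm_le_abs_re_add_abs_im (s - 1)
    simp only [Complex.sub_re, Complex.one_re, Complex.sub_im, Complex.one_im, sub_zero] at h4
    have h5 : |s.re - 1| ≤ |b| + 1 := by
      rw [abs_le]; constructor <;> linarith [le_abs_self b, abs_nonneg b]
    have h6 : |b| + 1 ≤ (|b| + 1) * |s.im| := le_mul_of_one_le_right (by positivity) h3
    linarith
  have h2p : ‖(2 : ℂ) ^ (s - 1)‖ ≤ 2 ^ (b - 1) := by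
    have := Complex.norm_cpow_eq_rpow_re_of_pos (x := 2) two_pos (s - 1)
    rw [show ((2 : ℝ) : ℂ) = 2 by norm_num] at this
    rw [this]
    exact Real.rpow_le_rpow_of_exponent_le (by norm_num) (by simp; linarith)
  have hpp : ‖(π : ℂ) ^ ((s - 1) / 2)‖ ≤ π ^ ((b - 1) / 2) := by
    rw [Complex.norm_cpow_eq_rpow_re_of_pos Real.pi_pos]
    exact Real.rpow_le_rpow_of_exponent_le (by linarith [Real.pi_gt_three]) (by simp; linarith)
  have hsq : ‖(√π : ℂ)‖ = √π := by
    rw [Complex.norm_real]; exact Real.norm_of_nonneg (Real.sqrt_nonneg _)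
  have hK1' : ‖Complex.Gamma (s / 2)‖ * |s.im| ^ (n + 1) ≤ 2 ^ (n + 1) * K1 := by
    have : |(s / 2).im| = |s.im| / 2 := by simp [abs_div]
    rw [this, div_pow, ← mul_div_assoc, div_le_iff₀ (by positivity)] at hK1s
    linarith
  have hK2n : 0 ≤ K2 + 1 + 1 := (norm_nonneg _).trans hL
  simp only [norm_mul, norm_div ((2 : ℂ) ^ (s - 1)), hsq]
  calc _ ≤ 2 ^ (b - 1) / √π * π ^ ((b - 1) / 2) * ((|b| + 1 + 1) / 2 * |s.im|) * ‖Complex.Gamma (s / 2)‖ * (K2 + 1 + 1) * |s.im| ^ n := by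
        gcongr
    _ = (2 ^ (b - 1) / √π * π ^ ((b - 1) / 2) * ((|b| + 1 + 1) / 2)) * (‖Complex.Gamma (s / 2)‖ * |s.im| ^ (n + 1)) * (K2 + 1 + 1) := by ring
    _ ≤ _ := by gcongr

/-! ### Contour shift and Mellin inversion -/

lemma vertical_integrable_aux {H : ℂ → ℂ} {σ K Y : ℝ}
    (hc : Continuous fun y : ℝ => H (σ + y * Complex.I))
    (hK : ∀ y : ℝ, Y ≤ |y| → ‖H (σ + y * Complex.I)‖ * |y| ^ 2 ≤ K) :
    Integrable fun y : ℝ => H (σ + y * Complex.I) := by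
  have hO : (fun y : ℝ => H (σ + y * Complex.I)) =O[cocompact ℝ] fun y : ℝ => (1 + y ^ 2)⁻¹ := by
    refine IsBigO.of_bound (2 * K) ?_
    have : ∀ᶠ y : ℝ in cocompact ℝ, max Y 1 ≤ ‖y‖ :=
      tendsto_norm_cocompact_atTop.eventually (eventually_ge_atTop _)
    filter_upwards [this] with y hy
    rw [Real.norm_eq_abs] at hy
    have h1 := hK y ((le_max_left _ _).trans hy)
    have hy1 : 1 ≤ |y| := (le_max_right _ _).trans hy
    rw [sq_abs] at h1
    have hy2 : 1 ≤ y ^ 2 := by rw [← sq_abs]; nlinarith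
    rw [Real.norm_of_nonneg (by positivity), ← div_eq_mul_inv, le_div_iff₀ (by positivity)]
    nlinarith [norm_nonneg (H (σ + y * Complex.I))]
  exact hc.locallyIntegrable.integrable_of_isBigO_cocompact hO
    (integrable_inv_one_add_sq.integrableAtFilter _)

lemma contour_shift {H : ℂ → ℂ} {a c K Y : ℝ} (hac : a ≤ c)
    (hd : DifferentiableOn ℂ H {s | a ≤ s.re})
    (hK : ∀ s : ℂ, a ≤ s.re → s.re ≤ c → Y ≤ |s.im| → ‖H s‖ * |s.im| ^ 2 ≤ K)
    {x : ℝ} (hx : 0 < x) : mellinInv a H x = mellinInv c H x := by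
  have hcont : ∀ σ : ℝ, a ≤ σ → Continuous fun y : ℝ => H (σ + y * Complex.I) := by
    intro σ hσ
    refine hd.continuousOn.comp_continuous (by fun_prop) (fun y => ?_)
    simpa using hσ
  set f : ℂ → ℂ := fun s => (x : ℂ) ^ (-s) * H s with hf
  have hx0 : (x : ℂ) ≠ 0 := by exact_mod_cast hx.ne'
  have hfd : DifferentiableOn ℂ f {s | a ≤ s.re} := by
    refine DifferentiableOn.mul ?_ hd
    intro s _
    exact (DifferentiableAt.const_cpow (by fun_prop) (Or.inl hx0)).differentiableWithinAt
  have hnx : ∀ s : ℂ, ‖(x : ℂ) ^ (-s)‖ = x ^ (-s.re) := by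
    intro s; rw [Complex.norm_cpow_eq_rpow_re_of_pos hx, Complex.neg_re]
  have hint : ∀ σ : ℝ, a ≤ σ → σ ≤ c → Integrable fun y : ℝ => f (σ + y * Complex.I) := by
    intro σ h1 h2
    refine vertical_integrable_aux (K := x ^ (-σ) * K) (Y := Y) ?_ ?_
    · refine hfd.continuousOn.comp_continuous (by fun_prop) (fun y => ?_)
      simpa using h1
    · intro y hy
      have := hK (σ + y * Complex.I) (by simpa using h1) (by simpa using h2) (by simpa using hy)
      simp only [hf, norm_mul, hnx]
      simp at this ⊢
      rw [mul_assoc]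
      exact mul_le_mul_of_nonneg_left this (Real.rpow_nonneg hx.le _)
  have hlim : ∀ σ : ℝ, a ≤ σ → σ ≤ c → Tendsto (fun T : ℝ => ∫ y in (-T)..T, f (σ + y * Complex.I))
      atTop (𝓝 (∫ y : ℝ, f (σ + y * Complex.I))) := fun σ h1 h2 =>
    intervalIntegral_tendsto_integral (hint σ h1 h2) tendsto_neg_atTop_atBot tendsto_id
  have hrect : ∀ T : ℝ, (∫ u in a..c, f (u + ((-T : ℝ) : ℂ) * Complex.I)) - (∫ u in a..c, f (u + (T : ℂ) * Complex.I))
      + Complex.I • (∫ y in (-T)..T, f (c + y * Complex.I))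
      - Complex.I • (∫ y in (-T)..T, f (a + y * Complex.I)) = 0 := by
    intro T
    have := Complex.integral_boundary_rect_eq_zero_of_differentiableOn f
      ((a : ℂ) + ((-T : ℝ) : ℂ) * Complex.I) ((c : ℂ) + (T : ℂ) * Complex.I) (hfd.mono ?_)
    · simpa using this
    · intro s hs
      have := hs.1
      simp [Set.uIcc_of_le hac] at this
      exact this.1
  have hhor : ∀ ε : ℝ, |ε| = 1 → Tendsto (fun T : ℝ => ∫ u in a..c, f (u + ((ε * T : ℝ) : ℂ) * Complex.I))
      atTop (𝓝 0) := by
    intro ε hε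
    set X := x ^ (-a) + x ^ (-c) with hX
    have hb : ∀ᶠ T : ℝ in atTop, ‖∫ u in a..c, f (u + ((ε * T : ℝ) : ℂ) * Complex.I)‖ ≤
        X * K / T ^ 2 * |c - a| := by
      filter_upwards [eventually_ge_atTop (max Y 1)] with T hT
      refine intervalIntegral.norm_integral_le_of_norm_le_const (fun u hu => ?_)
      rw [Set.uIoc_of_le hac] at hu
      have hT1 : 1 ≤ T := (le_max_right _ _).trans hT
      have hab : |ε * T| = T := by rw [abs_mul, hε, one_mul, abs_of_pos (by linarith)]
      have him : (u + ((ε * T : ℝ) : ℂ) * Complex.I).im = ε * T := by simp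
      have hre : (u + ((ε * T : ℝ) : ℂ) * Complex.I).re = u := by simp
      have := hK (u + ((ε * T : ℝ) : ℂ) * Complex.I) (by rw [hre]; exact hu.1.le)
        (by rw [hre]; exact hu.2) (by rw [him, hab]; exact (le_max_left _ _).trans hT)
      rw [him, hab] at this
      rw [hf]
      simp only [norm_mul, hnx, hre]
      rw [le_div_iff₀ (by positivity), mul_assoc]
      have hKn : 0 ≤ K := le_trans (by positivity) this
      refine mul_le_mul ?_ this (by positivity) (by positivity)
      rcases le_total x 1 with h | h
      · exact (Real.rpow_le_rpow_of_exponent_ge hx h (by linarith [hu.2])).trans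
          (le_add_of_nonneg_left (Real.rpow_nonneg hx.le _))
      · exact (Real.rpow_le_rpow_of_exponent_le h (by linarith [hu.1])).trans
          (le_add_of_nonneg_right (Real.rpow_nonneg hx.le _))
    refine squeeze_zero_norm' hb ?_
    have : Tendsto (fun T : ℝ => X * K / T ^ 2) atTop (𝓝 0) :=
      tendsto_const_nhds.div_atTop (tendsto_pow_atTop two_ne_zero)
    simpa using this.mul_const |c - a|
  have h1 := hhor (-1) (by simp)
  have h2 := hhor 1 (by simp)
  have h3 := ((h1.sub h2).add ((hlim c hac le_rfl).const_smul Complex.I)).sub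
    ((hlim a le_rfl hac).const_smul Complex.I)
  have h4 : Complex.I • (∫ y : ℝ, f (c + y * Complex.I)) - Complex.I • (∫ y : ℝ, f (a + y * Complex.I)) = 0 := by
    have := tendsto_nhds_unique (h3.congr (fun T => by simpa using hrect T)) (tendsto_const_nhds (x := (0 : ℂ)))
    simpa using this
  rw [← smul_sub, smul_eq_zero] at h4
  have h5 := sub_eq_zero.1 (h4.resolve_left Complex.I_ne_zero)
  simp only [mellinInv, smul_eq_mul]
  rw [h5]

lemma mellin_core {F : ℝ → ℂ} {H : ℂ → ℂ} {a c K Y : ℝ} (hac : a ≤ c)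
    (hd : DifferentiableOn ℂ H {s | a ≤ s.re})
    (hK : ∀ s : ℂ, a ≤ s.re → s.re ≤ c → Y ≤ |s.im| → ‖H s‖ * |s.im| ^ 2 ≤ K)
    (hF : MellinConvergent F c) (hFH : ∀ s : ℂ, s.re = c → mellin F s = H s) :
    ∃ C : ℝ, ∀ x : ℝ, 0 < x → ContinuousAt F x → ‖F x‖ ≤ C * x ^ (-a) := by
  refine ⟨(1 / (2 * π)) * ∫ y : ℝ, ‖H (a + y * Complex.I)‖, fun x hx hFx => ?_⟩
  have hmF : ∀ y : ℝ, mellin F (c + y * Complex.I) = H (c + y * Complex.I) := fun y =>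
    hFH _ (by simp)
  have hV : Complex.VerticalIntegrable (mellin F) c := by
    rw [Complex.VerticalIntegrable]
    simp only [hmF]
    refine vertical_integrable_aux (K := K) (Y := Y) ?_ ?_
    · refine hd.continuousOn.comp_continuous (by fun_prop) (fun y => ?_)
      simpa using hac
    · intro y hy
      have := hK (c + y * Complex.I) (by simpa using hac) (by simp) (by simpa using hy)
      simpa using this
  have h1 := mellinInv_mellin_eq c F hx hF hV hFx
  have h2 : mellinInv c (mellin F) x = mellinInv c H x := by
    simp only [mellinInv, hmF]
  rw [← h1, h2, ← contour_shift hac hd hK hx, mellinInv, norm_smul]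
  have : ‖((1 / (2 * π) : ℝ) : ℝ)‖ = 1 / (2 * π) := Real.norm_of_nonneg (by positivity)
  have h3 : ‖∫ y : ℝ, (x : ℂ) ^ (-((a : ℂ) + y * Complex.I)) • H (a + y * Complex.I)‖ ≤
      (∫ y : ℝ, ‖H (a + y * Complex.I)‖) * x ^ (-a) := by
    refine (norm_integral_le_integral_norm _).trans (le_of_eq ?_)
    rw [← integral_mul_const]
    congr 1
    ext y
    rw [norm_smul, Complex.norm_cpow_eq_rpow_re_of_pos hx]
    simp [mul_comm]
  rw [mul_assoc]
  refine mul_le_mul (le_of_eq ?_) h3 (norm_nonneg _) (by positivity)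
  simp [abs_of_pos Real.pi_pos]

/-! ### Power series with non-negative coefficients -/

lemma psum_summable {ι : Type*} {a : ι → ℝ} (ha : ∀ i, 0 ≤ a i) {n : ι → ℕ}
    (H : ∀ r : ℝ, 0 < r → r < 1 → Summable fun i => a i * r ^ n i) (r : ℝ) (hr : 0 < r)
    (hr1 : r < 1) : Summable fun i => a i * n i * r ^ (n i - 1) := by
  set r' := (1 + r) / 2 with hr'
  have h0 : 0 < r' := by rw [hr']; linarith
  have hq : r / r' < 1 := by rw [div_lt_one h0, hr']; linarith
  have hq0 : 0 ≤ r / r' := by positivity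
  obtain ⟨C, hC⟩ := (tendsto_self_mul_const_pow_of_lt_one hq0 hq).bddAbove_range
  have hs := (H r' h0 (by rw [hr']; linarith)).mul_left (C / r)
  refine Summable.of_nonneg_of_le (fun i => by have := ha i; positivity) (fun i => ?_) hs
  have h1 : (n i : ℝ) * (r / r') ^ n i ≤ C := hC ⟨n i, rfl⟩
  rw [div_pow, ← mul_div_assoc, div_le_iff₀ (by positivity)] at h1
  rcases Nat.eq_zero_or_pos (n i) with h | h
  · have hC0 : 0 ≤ C := by simpa [h] using h1
    have := ha i
    simp only [h, Nat.cast_zero, mul_zero, zero_mul]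
    positivity
  · have h2 : r ^ n i = r ^ (n i - 1) * r := by rw [← pow_succ, Nat.sub_add_cancel h]
    have h3 : (n i : ℝ) * r ^ (n i - 1) ≤ C / r * r' ^ n i := by
      rw [div_mul_eq_mul_div, le_div_iff₀ hr, mul_assoc, ← h2]; exact h1
    calc a i * n i * r ^ (n i - 1) = a i * (n i * r ^ (n i - 1)) := by ring
      _ ≤ a i * (C / r * r' ^ n i) := mul_le_mul_of_nonneg_left h3 (ha i)
      _ = _ := by ring

lemma psum_hasDerivAt {ι : Type*} {a : ι → ℝ} (ha : ∀ i, 0 ≤ a i) {n : ι → ℕ}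
    (H : ∀ r : ℝ, 0 < r → r < 1 → Summable fun i => a i * r ^ n i) (x : ℝ) (hx : 0 < x)
    (hx1 : x < 1) : HasDerivAt (fun y : ℝ => ∑' i, a i * y ^ n i)
      (∑' i, a i * n i * x ^ (n i - 1)) x := by
  set r := (1 + x) / 2 with hr
  have hs := psum_summable ha H r (by rw [hr]; linarith) (by rw [hr]; linarith)
  refine hasDerivAt_tsum_of_isPreconnected (t := Set.Ioo 0 r) hs isOpen_Ioo isPreconnected_Ioo
    (g := fun i y => a i * y ^ n i) (g' := fun i y => a i * n i * y ^ (n i - 1)) ?_ ?_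
    (y₀ := x) ⟨hx, by rw [hr]; linarith⟩ (H x hx hx1) ⟨hx, by rw [hr]; linarith⟩
  · intro i y _
    have := (hasDerivAt_pow (n i) y).const_mul (a i)
    rwa [← mul_assoc] at this
  · intro i y hy
    have := ha i
    have h0 := hy.1
    rw [Real.norm_of_nonneg (by positivity)]
    gcongr
    exact hy.2.le

lemma exp_neg_le_rpow {σ : ℝ} (hσ : 0 < σ) {u : ℝ} (hu : 0 < u) :
    Real.exp (-u) ≤ σ ^ σ * u ^ (-σ) := by
  have h1 : u / σ ≤ Real.exp (u / σ) := by linarith [Real.add_one_le_exp (u / σ)]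
  have h2 := Real.rpow_le_rpow (by positivity) h1 hσ.le
  rw [← Real.exp_mul, div_mul_cancel₀ _ hσ.ne', Real.div_rpow hu.le hσ.le,
    div_le_iff₀ (by positivity)] at h2
  rw [Real.exp_neg, Real.rpow_neg hu.le, ← div_eq_mul_inv, le_div_iff₀ (by positivity),
    inv_mul_le_iff₀ (Real.exp_pos _)]
  exact h2

/-- coefficients indexed by pairs -/
def pc (b : ℕ → ℝ) (p : ℕ × ℕ) : ℝ := b (p.1 + 1) / ((p.2 : ℝ) + 1)

/-- exponents indexed by pairs -/
def pn (p : ℕ × ℕ) : ℕ := (p.1 + 1) * (p.2 + 1)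

lemma pn_pos (p : ℕ × ℕ) : 0 < pn p := by unfold pn; positivity

lemma pc_nonneg {b : ℕ → ℝ} (hb : ∀ k, 0 ≤ b k) (p : ℕ × ℕ) : 0 ≤ pc b p := by
  have := hb (p.1 + 1)
  unfold pc; positivity

lemma dirichlet_real_summable {b : ℕ → ℝ} (hb : ∀ k, 0 ≤ b k) {ρ C₀ A : ℝ} {Dc : ℂ → ℂ}
    (h1 : M1 b ρ C₀ A Dc) {σ : ℝ} (hσ : ρ < σ) :
    Summable fun k : ℕ => b (k + 1) * ((k : ℝ) + 1) ^ (-σ) := by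
  obtain ⟨_, _, _, _, hS, _⟩ := h1
  have := (hS (σ : ℂ) (by simpa using hσ)).summable.norm
  refine this.congr (fun k => ?_)
  rw [norm_mul, Complex.norm_natCast_cpow_of_pos (Nat.succ_pos k), Complex.norm_real,
    Real.norm_of_nonneg (hb _)]
  simp

lemma pair_summable {b : ℕ → ℝ} (hb : ∀ k, 0 ≤ b k) {ρ C₀ A : ℝ} {Dc : ℂ → ℂ}
    (h1 : M1 b ρ C₀ A Dc) {σ : ℝ} (hσ : ρ < σ) :
    Summable fun p : ℕ × ℕ => pc b p * (pn p : ℝ) ^ (-σ) := by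
  have hσ0 : 0 < σ := h1.1.trans hσ
  have hz : Summable fun j : ℕ => ((j : ℝ) + 1) ^ (-(σ + 1)) := by
    have := (summable_nat_add_iff 1).2 (Real.summable_nat_rpow.2 (show -(σ + 1) < -1 by linarith))
    simpa using this
  refine ((dirichlet_real_summable hb h1 hσ).mul_of_nonneg hz
    (fun k => ?_) (fun j => ?_)).congr (fun p => ?_)
  · have := hb (k + 1)
    simp only [Pi.zero_apply]; positivity
  · simp only [Pi.zero_apply]; positivity
  · unfold pc pn
    push_cast
    rw [Real.mul_rpow (by positivity) (by positivity), neg_add, Real.rpow_add (by positivity),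
      Real.rpow_neg_one]
    ring

lemma pair_pow_summable {b : ℕ → ℝ} (hb : ∀ k, 0 ≤ b k) {ρ C₀ A : ℝ} {Dc : ℂ → ℂ}
    (h1 : M1 b ρ C₀ A Dc) (m : ℕ) (r : ℝ) (hr : 0 < r) (hr1 : r < 1) :
    Summable fun p : ℕ × ℕ => pc b p * (pn p : ℝ) ^ m * r ^ pn p := by
  have hρ := h1.1
  set τ : ℝ := ρ + 1 + m with hτ
  have hτ0 : 0 < τ := by positivity
  set t := -Real.log r with ht
  have ht0 : 0 < t := by rw [ht]; linarith [Real.log_neg hr hr1]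
  refine Summable.of_nonneg_of_le (fun p => ?_) (fun p => ?_)
    ((pair_summable hb h1 (show ρ < ρ + 1 by linarith)).mul_left (τ ^ τ * t ^ (-τ)))
  · have := pc_nonneg hb p
    positivity
  · have hn : (0 : ℝ) < pn p := by exact_mod_cast pn_pos p
    have h2 : r ^ pn p = Real.exp (-(pn p * t)) := by
      rw [ht, mul_neg, neg_neg, mul_comm, Real.exp_mul, Real.exp_log hr, Real.rpow_natCast]
    have h3 := exp_neg_le_rpow hτ0 (show 0 < (pn p : ℝ) * t by positivity)
    rw [Real.mul_rpow hn.le ht0.le] at h3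
    have h4 : (pn p : ℝ) ^ m * (pn p : ℝ) ^ (-τ) = (pn p : ℝ) ^ (-(ρ + 1)) := by
      rw [← Real.rpow_natCast, ← Real.rpow_add hn]; congr 1; rw [hτ]; ring
    have hp := pc_nonneg hb p
    calc pc b p * (pn p : ℝ) ^ m * r ^ pn p ≤
        pc b p * (pn p : ℝ) ^ m * (τ ^ τ * ((pn p : ℝ) ^ (-τ) * t ^ (-τ))) := by
          rw [h2]; gcongr
      _ = τ ^ τ * t ^ (-τ) * (pc b p * ((pn p : ℝ) ^ m * (pn p : ℝ) ^ (-τ))) := by ring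
      _ = _ := by rw [h4]

lemma Fb_eq {b : ℕ → ℝ} (hb : ∀ k, 0 ≤ b k) {ρ C₀ A : ℝ} {Dc : ℂ → ℂ}
    (h1 : M1 b ρ C₀ A Dc) (x : ℝ) (hx : 0 < x) (hx1 : x < 1) :
    Fb b x = ∑' p : ℕ × ℕ, pc b p * x ^ pn p := by
  have hs : Summable fun p : ℕ × ℕ => pc b p * x ^ pn p := by
    simpa using pair_pow_summable hb h1 0 x hx hx1
  rw [hs.tsum_prod, Fb, ← tsum_neg]
  congr 1
  ext k
  have hlt : |x ^ (k + 1)| < 1 := by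
    rw [abs_of_pos (by positivity)]; exact pow_lt_one₀ hx.le hx1 (by omega)
  have := (Real.hasSum_pow_div_log_of_abs_lt_one hlt).mul_left (b (k + 1))
  rw [← mul_neg, ← this.tsum_eq]
  congr 1
  ext j
  simp only [pc, pn]
  rw [← pow_mul]; ring

/-- `∑ b_k k² j e^{-kjt}`. -/
def Gs (b : ℕ → ℝ) (t : ℝ) : ℝ := ∑' p : ℕ × ℕ, pc b p * (pn p : ℝ) ^ 2 * Real.exp (-t) ^ pn p


lemma derivs {b : ℕ → ℝ} {ρ C₀ A : ℝ} {Dc : ℂ → ℂ} (x : ℝ) (hx : 0 < x) (hx1 : x < 1) :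
    M1 b ρ C₀ A Dc → (∀ k, 0 ≤ b k) →
    deriv (Fb b) x = ∑' p : ℕ × ℕ, pc b p * pn p * x ^ (pn p - 1) ∧
    iteratedDeriv 2 (Fb b) x = ∑' p : ℕ × ℕ, pc b p * pn p * (pn p - 1 : ℕ) * x ^ (pn p - 1 - 1) ∧
    iteratedDeriv 3 (Fb b) x =
      ∑' p : ℕ × ℕ, pc b p * pn p * (pn p - 1 : ℕ) * (pn p - 1 - 1 : ℕ) * x ^ (pn p - 1 - 1 - 1) := by
  intro h1 hb
  have H0 : ∀ r : ℝ, 0 < r → r < 1 → Summable fun p => pc b p * r ^ pn p := fun r h h' => by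
    simpa using pair_pow_summable hb h1 0 r h h'
  have a0 := pc_nonneg hb
  have H1 := psum_summable a0 H0
  have a1 : ∀ p, 0 ≤ pc b p * pn p := fun p => mul_nonneg (a0 p) (Nat.cast_nonneg _)
  have H2 := psum_summable a1 H1
  have a2 : ∀ p, 0 ≤ pc b p * pn p * (pn p - 1 : ℕ) := fun p => mul_nonneg (a1 p) (Nat.cast_nonneg _)
  have hnhds : ∀ y : ℝ, 0 < y → y < 1 → ∀ᶠ z in 𝓝 y, 0 < z ∧ z < 1 := fun y h h' =>
    Ioo_mem_nhds h h'
  have D1 : ∀ y : ℝ, 0 < y → y < 1 → deriv (Fb b) y = ∑' p : ℕ × ℕ, pc b p * pn p * y ^ (pn p - 1) := by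
    intro y h h'
    rw [← (psum_hasDerivAt a0 H0 y h h').deriv]
    exact Filter.EventuallyEq.deriv_eq ((hnhds y h h').mono fun z hz => Fb_eq hb h1 z hz.1 hz.2)
  have D2 : ∀ y : ℝ, 0 < y → y < 1 → iteratedDeriv 2 (Fb b) y =
      ∑' p : ℕ × ℕ, pc b p * pn p * (pn p - 1 : ℕ) * y ^ (pn p - 1 - 1) := by
    intro y h h'
    rw [← (psum_hasDerivAt a1 H1 y h h').deriv, iteratedDeriv_succ, iteratedDeriv_one]
    exact Filter.EventuallyEq.deriv_eq ((hnhds y h h').mono fun z hz => D1 z hz.1 hz.2)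
  refine ⟨D1 x hx hx1, D2 x hx hx1, ?_⟩
  rw [← (psum_hasDerivAt a2 H2 x hx hx1).deriv, iteratedDeriv_succ]
  exact Filter.EventuallyEq.deriv_eq ((hnhds x hx hx1).mono fun z hz => D2 z hz.1 hz.2)


lemma Bbf_eq {b : ℕ → ℝ} (hb : ∀ k, 0 ≤ b k) {ρ C₀ A : ℝ} {Dc : ℂ → ℂ}
    (h1 : M1 b ρ C₀ A Dc) (t : ℝ) (ht : 0 < t) : Bbf b (Real.exp (-t)) = Gs b t := by
  set x := Real.exp (-t) with hx
  have hx0 : 0 < x := Real.exp_pos _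
  have hx1 : x < 1 := by rw [hx, Real.exp_lt_one_iff]; linarith
  obtain ⟨d1, d2, -⟩ := derivs x hx0 hx1 h1 hb
  have H0 : ∀ r : ℝ, 0 < r → r < 1 → Summable fun p => pc b p * r ^ pn p := fun r h h' => by
    simpa using pair_pow_summable hb h1 0 r h h'
  have a0 := pc_nonneg hb
  have H1 := psum_summable a0 H0
  have a1 : ∀ p, 0 ≤ pc b p * pn p := fun p => mul_nonneg (a0 p) (Nat.cast_nonneg _)
  have H2 := psum_summable a1 H1
  rw [Bbf, d1, d2, ← tsum_mul_left, ← tsum_mul_left,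
    ← ((H2 x hx0 hx1).mul_left _).tsum_add ((H1 x hx0 hx1).mul_left _), Gs]
  congr 1
  ext p
  rw [← hx]
  obtain ⟨m, hm⟩ : ∃ m, pn p = m + 1 := ⟨pn p - 1, by have := pn_pos p; omega⟩
  rw [hm]
  rcases m with _ | m
  · simp; ring
  · simp only [Nat.add_sub_cancel]
    push_cast
    ring

lemma third_bound {b : ℕ → ℝ} (hb : ∀ k, 0 ≤ b k) {ρ C₀ A : ℝ} {Dc : ℂ → ℂ}
    (h1 : M1 b ρ C₀ A Dc) (t : ℝ) (ht : 0 < t) :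
    |iteratedDeriv 3 (Fb b) (Real.exp (-t))| ≤ Real.exp (3 * t) * (2 / t) * Gs b (t / 2) := by
  set x := Real.exp (-t) with hx
  have hx0 : 0 < x := Real.exp_pos _
  have hx1 : x < 1 := by rw [hx, Real.exp_lt_one_iff]; linarith
  obtain ⟨-, -, d3⟩ := derivs x hx0 hx1 h1 hb
  have a0 := pc_nonneg hb
  have hsum := (pair_pow_summable hb h1 2 (Real.exp (-(t / 2))) (Real.exp_pos _)
    (by rw [Real.exp_lt_one_iff]; linarith)).mul_left (Real.exp (3 * t) * (2 / t))
  have hle : ∀ p : ℕ × ℕ,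
      pc b p * pn p * (pn p - 1 : ℕ) * (pn p - 1 - 1 : ℕ) * x ^ (pn p - 1 - 1 - 1) ≤
      Real.exp (3 * t) * (2 / t) * (pc b p * (pn p : ℝ) ^ 2 * Real.exp (-(t / 2)) ^ pn p) := by
    intro p
    have hp := a0 p
    by_cases h3 : 3 ≤ pn p
    · have e1 : x ^ (pn p - 1 - 1 - 1) = Real.exp (3 * t) * x ^ pn p := by
        have : x ^ pn p = x ^ (pn p - 1 - 1 - 1) * x ^ 3 := by
          rw [← pow_add]; congr 1; omega
        rw [this, hx, ← Real.exp_nat_mul (-t) 3, mul_comm, mul_assoc, ← Real.exp_add]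
        simp
      have e2 : x ^ pn p = Real.exp (-(t / 2)) ^ pn p * Real.exp (-(pn p * (t / 2))) := by
        rw [hx, ← Real.exp_nat_mul, ← Real.exp_nat_mul, ← Real.exp_add]; congr 1; ring
      have e3 : (pn p : ℝ) * Real.exp (-(pn p * (t / 2))) ≤ 2 / t := by
        have := Real.add_one_le_exp ((pn p : ℝ) * (t / 2))
        rw [Real.exp_neg, ← div_eq_mul_inv, div_le_div_iff₀ (Real.exp_pos _) ht]
        linarith
      have e4 : ((pn p - 1 : ℕ) : ℝ) ≤ pn p := by exact_mod_cast Nat.sub_le _ _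
      have e5 : ((pn p - 1 - 1 : ℕ) : ℝ) ≤ pn p := by
        exact_mod_cast (Nat.sub_le _ _).trans (Nat.sub_le _ _)
      calc _ ≤ pc b p * pn p * pn p * pn p * x ^ (pn p - 1 - 1 - 1) := by gcongr
        _ = Real.exp (3 * t) * ((pn p : ℝ) * Real.exp (-(pn p * (t / 2)))) *
            (pc b p * (pn p : ℝ) ^ 2 * Real.exp (-(t / 2)) ^ pn p) := by rw [e1, e2]; ring
        _ ≤ _ := by gcongr
    · have : pc b p * pn p * (pn p - 1 : ℕ) * (pn p - 1 - 1 : ℕ) = 0 := by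
        have := pn_pos p
        have h : pn p - 1 = 0 ∨ pn p - 1 - 1 = 0 := by omega
        rcases h with h | h <;> simp [h]
      rw [this, zero_mul]
      positivity
  have hnn : ∀ p : ℕ × ℕ,
      0 ≤ pc b p * pn p * (pn p - 1 : ℕ) * (pn p - 1 - 1 : ℕ) * x ^ (pn p - 1 - 1 - 1) := by
    intro p
    have hp := a0 p
    positivity
  rw [d3, abs_of_nonneg (tsum_nonneg hnn), Gs, ← tsum_mul_left]
  exact (Summable.of_nonneg_of_le hnn hle hsum).tsum_le_tsum hle hsum

/-! ### The Mellin transform of `Gs` -/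

lemma Gs_nonneg {b : ℕ → ℝ} (hb : ∀ k, 0 ≤ b k) (t : ℝ) : 0 ≤ Gs b t := by
  refine tsum_nonneg fun p => ?_
  have := pc_nonneg hb p
  positivity

lemma Gs_continuousAt {b : ℕ → ℝ} (hb : ∀ k, 0 ≤ b k) {ρ C₀ A : ℝ} {Dc : ℂ → ℂ}
    (h1 : M1 b ρ C₀ A Dc) (t : ℝ) (ht : 0 < t) : ContinuousAt (Gs b) t := by
  have h := psum_hasDerivAt (a := fun p => pc b p * (pn p : ℝ) ^ 2) (n := pn)
    (fun p => mul_nonneg (pc_nonneg hb p) (by positivity)) (pair_pow_summable hb h1 2)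
    (Real.exp (-t)) (Real.exp_pos _) (by rw [Real.exp_lt_one_iff]; linarith)
  have h2 : ContinuousAt (fun t : ℝ => Real.exp (-t)) t := by fun_prop
  exact ContinuousAt.comp (f := fun t : ℝ => Real.exp (-t)) h.continuousAt h2

lemma Gs_hasSum {b : ℕ → ℝ} (hb : ∀ k, 0 ≤ b k) {ρ C₀ A : ℝ} {Dc : ℂ → ℂ}
    (h1 : M1 b ρ C₀ A Dc) (t : ℝ) (ht : 0 < t) :
    HasSum (fun p => pc b p * (pn p : ℝ) ^ 2 * Real.exp (-(pn p : ℝ) * t)) (Gs b t) := by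
  have h := (pair_pow_summable hb h1 2 (Real.exp (-t)) (Real.exp_pos _)
    (by rw [Real.exp_lt_one_iff]; linarith)).hasSum
  convert! h using 3 with p
  rw [← Real.exp_nat_mul]; congr 1; ring

lemma Gs_le {b : ℕ → ℝ} (hb : ∀ k, 0 ≤ b k) {ρ C₀ A : ℝ} {Dc : ℂ → ℂ}
    (h1 : M1 b ρ C₀ A Dc) {σ : ℝ} (hσ : ρ + 2 < σ) :
    ∃ C : ℝ, ∀ t : ℝ, 0 < t → Gs b t ≤ C * t ^ (-σ) := by
  have hρ := h1.1
  have hσ0 : 0 < σ := by linarith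
  have hs := pair_summable hb h1 (show ρ < σ - 2 by linarith)
  refine ⟨σ ^ σ * ∑' p, pc b p * (pn p : ℝ) ^ (-(σ - 2)), fun t ht => ?_⟩
  have h := Gs_hasSum hb h1 t ht
  rw [mul_right_comm]
  refine hasSum_le ?_ h (hs.hasSum.mul_left (σ ^ σ * t ^ (-σ)))
  intro p
  have hn : (0 : ℝ) < pn p := by exact_mod_cast pn_pos p
  have h3 := exp_neg_le_rpow hσ0 (show 0 < (pn p : ℝ) * t by positivity)
  rw [Real.mul_rpow hn.le ht.le] at h3
  have h4 : (pn p : ℝ) ^ 2 * (pn p : ℝ) ^ (-σ) = (pn p : ℝ) ^ (-(σ - 2)) := by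
    rw [← Real.rpow_natCast, ← Real.rpow_add hn]; congr 1; push_cast; ring
  have hp := pc_nonneg hb p
  calc pc b p * (pn p : ℝ) ^ 2 * Real.exp (-(pn p : ℝ) * t) ≤
      pc b p * (pn p : ℝ) ^ 2 * (σ ^ σ * ((pn p : ℝ) ^ (-σ) * t ^ (-σ))) := by
        rw [neg_mul]; gcongr
    _ = σ ^ σ * t ^ (-σ) * (pc b p * ((pn p : ℝ) ^ 2 * (pn p : ℝ) ^ (-σ))) := by ring
    _ = _ := by rw [h4]

lemma Gs_mellinConvergent {b : ℕ → ℝ} (hb : ∀ k, 0 ≤ b k) {ρ C₀ A : ℝ} {Dc : ℂ → ℂ}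
    (h1 : M1 b ρ C₀ A Dc) {s : ℂ} (hs : ρ + 2 < s.re) :
    MellinConvergent (fun t => (Gs b t : ℂ)) s := by
  have key : ∀ σ : ℝ, ρ + 2 < σ → ∃ C : ℝ, ∀ t : ℝ, 0 < t → ‖(Gs b t : ℂ)‖ ≤ C * ‖t ^ (-σ)‖ := by
    intro σ hσ
    obtain ⟨C, hC⟩ := Gs_le hb h1 hσ
    refine ⟨C, fun t ht => ?_⟩
    rw [Complex.norm_real, Real.norm_of_nonneg (Gs_nonneg hb t),
      Real.norm_of_nonneg (by positivity)]
    exact hC t ht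
  obtain ⟨C, hC⟩ := key (s.re + 1) (by linarith)
  obtain ⟨C', hC'⟩ := key ((ρ + 2 + s.re) / 2) (by linarith)
  refine mellinConvergent_of_isBigO_rpow (a := s.re + 1) (b := (ρ + 2 + s.re) / 2) ?_ ?_
    (by linarith) ?_ (by linarith)
  · refine ContinuousOn.locallyIntegrableOn ?_ measurableSet_Ioi
    intro t ht
    exact (Complex.continuous_ofReal.continuousAt.comp
      (Gs_continuousAt hb h1 t ht)).continuousWithinAt
  · exact IsBigO.of_bound C ((eventually_gt_atTop 0).mono fun t ht => hC t ht)
  · exact IsBigO.of_bound C' (eventually_mem_nhdsWithin.mono fun t ht => hC' t ht)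

lemma Gs_term (b : ℕ → ℝ) (s : ℂ) (p : ℕ × ℕ) :
    Complex.Gamma s * ((pc b p * (pn p : ℝ) ^ 2 : ℝ) : ℂ) / ((pn p : ℝ) : ℂ) ^ s =
    Complex.Gamma s * (((b (p.1 + 1) : ℂ) * ((p.1 + 1 : ℕ) : ℂ) ^ (-(s - 2))) *
      (1 / ((p.2 : ℂ) + 1) ^ (s - 1))) := by
  have hk : ((p.1 : ℂ) + 1) ≠ 0 := by exact_mod_cast Nat.succ_ne_zero p.1
  have hj : ((p.2 : ℂ) + 1) ≠ 0 := by exact_mod_cast Nat.succ_ne_zero p.2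
  have e1 : ((pn p : ℝ) : ℂ) ^ s = ((p.1 : ℂ) + 1) ^ s * ((p.2 : ℂ) + 1) ^ s := by
    have := Complex.mul_cpow_ofReal_nonneg (a := (p.1 : ℝ) + 1) (b := (p.2 : ℝ) + 1)
      (by positivity) (by positivity) s
    push_cast at this
    rw [← this]; simp [pn]
  have e2 : ((p.1 : ℂ) + 1) ^ (-(s - 2)) = ((p.1 : ℂ) + 1) ^ 2 / ((p.1 : ℂ) + 1) ^ s := by
    rw [neg_sub, Complex.cpow_sub _ _ hk]; norm_num
  have e3 : ((p.2 : ℂ) + 1) ^ (s - 1) = ((p.2 : ℂ) + 1) ^ s / ((p.2 : ℂ) + 1) := by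
    rw [Complex.cpow_sub _ _ hj, Complex.cpow_one]
  have e4 : ((pn p : ℕ) : ℂ) = ((p.1 : ℂ) + 1) * ((p.2 : ℂ) + 1) := by simp [pn]
  rw [e1]
  push_cast
  rw [e2, e3, e4]
  have n1 : ((p.1 : ℂ) + 1) ^ s ≠ 0 := by rw [Ne, Complex.cpow_eq_zero_iff]; tauto
  have n2 : ((p.2 : ℂ) + 1) ^ s ≠ 0 := by rw [Ne, Complex.cpow_eq_zero_iff]; tauto
  simp only [pc]
  push_cast
  field_simp

lemma Gs_hasSum_mellin {b : ℕ → ℝ} (hb : ∀ k, 0 ≤ b k) {ρ C₀ A : ℝ} {Dc : ℂ → ℂ}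
    (h1 : M1 b ρ C₀ A Dc) {s : ℂ} (hs : ρ + 2 < s.re) :
    HasSum (fun p : ℕ × ℕ =>
      Complex.Gamma s * ((pc b p * (pn p : ℝ) ^ 2 : ℝ) : ℂ) / ((pn p : ℝ) : ℂ) ^ s)
      (mellin (fun t => (Gs b t : ℂ)) s) := by
  have hρ := h1.1
  have hF : ∀ t ∈ Set.Ioi (0 : ℝ), HasSum (fun p : ℕ × ℕ => ((pc b p * (pn p : ℝ) ^ 2 : ℝ) : ℂ) *
      (Real.exp (-(pn p : ℝ) * t) : ℂ)) (Gs b t : ℂ) := by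
    intro t ht
    have := (Complex.hasSum_ofReal).2 (Gs_hasSum hb h1 t ht)
    simpa only [Complex.ofReal_mul] using this
  have hS : Summable fun p : ℕ × ℕ =>
      ‖((pc b p * (pn p : ℝ) ^ 2 : ℝ) : ℂ)‖ / (pn p : ℝ) ^ s.re := by
    refine (pair_summable hb h1 (show ρ < s.re - 2 by linarith)).congr (fun p => ?_)
    have hn : (0 : ℝ) < pn p := by exact_mod_cast pn_pos p
    rw [Complex.norm_real, Real.norm_of_nonneg (mul_nonneg (pc_nonneg hb p) (by positivity)),
      mul_div_assoc]
    congr 1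
    rw [eq_div_iff (by positivity), ← Real.rpow_natCast, ← Real.rpow_add hn]
    congr 1; push_cast; ring
  have hpos : ∀ p : ℕ × ℕ, ((pc b p * (pn p : ℝ) ^ 2 : ℝ) : ℂ) = 0 ∨ (0 : ℝ) < pn p :=
    fun p => Or.inr (by exact_mod_cast pn_pos p)
  exact hasSum_mellin hpos (by linarith) hF hS

lemma zeta_hasSum {s : ℂ} (hre1 : 1 < (s - 1).re) :
    HasSum (fun j : ℕ => 1 / ((j : ℂ) + 1) ^ (s - 1)) (riemannZeta (s - 1)) := by
  have hz0 : Summable fun j : ℕ => 1 / ((j : ℂ) + 1) ^ (s - 1) := by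
    have := (summable_nat_add_iff 1).2 (Complex.summable_one_div_nat_cpow.2 hre1)
    simpa using this
  rw [zeta_eq_tsum_one_div_nat_add_one_cpow hre1]
  exact hz0.hasSum

lemma hasSum_mul_pair {f g : ℕ → ℂ} {a b : ℂ} (hf : HasSum f a) (hg : HasSum g b) (c : ℂ) :
    HasSum (fun p : ℕ × ℕ => c * (f p.1 * g p.2)) (c * (a * b)) :=
  (hf.mul hg (summable_mul_of_summable_norm hf.summable.norm hg.summable.norm)).mul_left c

lemma Gs_mellin {b : ℕ → ℝ} (hb : ∀ k, 0 ≤ b k) {ρ C₀ A : ℝ} {Dc : ℂ → ℂ}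
    (h1 : M1 b ρ C₀ A Dc) {s : ℂ} (hs : ρ + 2 < s.re) :
    mellin (fun t => (Gs b t : ℂ)) s =
      Complex.Gamma s * riemannZeta (s - 1) * Dc (s - 2) := by
  have hρ := h1.1
  have hm := Gs_hasSum_mellin hb h1 hs
  have hre1 : 1 < (s - 1).re := by simp only [Complex.sub_re, Complex.one_re]; linarith
  have hre2 : ρ < (s - 2).re := by
    simp only [Complex.sub_re, Complex.re_ofNat]; linarith
  have hD := h1.2.2.2.2.1 (s - 2) hre2
  have hprod := hasSum_mul_pair hD (zeta_hasSum hre1) (Complex.Gamma s)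
  have hm2 := hm.congr_fun (fun p => (Gs_term b s p).symm)
  have h3 := hm2.unique hprod
  rw [h3]; ring

/-! ### The continuation of the Mellin transform with its principal parts removed -/

/-- The Mellin transform of `Gs`, multiplied by `(s-2)(s-ρ-2)`. -/
def Nf (φ : ℂ → ℂ) (ρ A : ℝ) (s : ℂ) : ℂ :=
  Complex.Gamma s * riemannZeta₁ (s - 1) * (A + (s - (ρ + 2)) * φ (s - 2))

/-- The Mellin transform of `Gs` minus the two modified principal parts. -/
def Hf (φ : ℂ → ℂ) (ρ A : ℝ) (s : ℂ) : ℂ :=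
  (1 / ρ) * (dslope (Nf φ ρ A) (ρ + 2) s - dslope (Nf φ ρ A) 2 s) +
    Nf φ ρ A (ρ + 2) / ρ * (1 / (s - (ρ + 2) + (ρ + 3))) +
    (-Nf φ ρ A 2 / ρ) * (1 / (s - 2 + (ρ + 3)))

lemma Nf_diff {φ : ℂ → ℂ} {ρ A C₀ : ℝ} (hC1 : C₀ < 1)
    (hφ : ∀ s : ℂ, -C₀ ≤ s.re → DifferentiableAt ℂ φ s) :
    DifferentiableOn ℂ (Nf φ ρ A) {s | 2 - C₀ ≤ s.re} := by
  intro s hs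
  have hs' : 2 - C₀ ≤ s.re := hs
  refine DifferentiableAt.differentiableWithinAt ?_
  unfold Nf
  have hG : DifferentiableAt ℂ Complex.Gamma s := by
    refine Complex.differentiableAt_Gamma s fun m h => ?_
    have := congrArg Complex.re h
    simp only [Complex.neg_re, Complex.natCast_re] at this
    have hm : (0 : ℝ) ≤ m := Nat.cast_nonneg m
    linarith
  have hz : DifferentiableAt ℂ (fun s => riemannZeta₁ (s - 1)) s :=
    DifferentiableAt.comp (f := fun s : ℂ => s - 1) (g := riemannZeta₁) s
      (differentiable_riemannZeta₁ (s - 1)) (differentiableAt_id.sub_const 1)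
  have hp : DifferentiableAt ℂ (fun s => φ (s - 2)) s := by
    refine DifferentiableAt.comp (f := fun s : ℂ => s - 2) s (hφ (s - 2) ?_) (differentiableAt_id.sub_const 2)
    simp only [Complex.sub_re, Complex.re_ofNat]; linarith
  exact (hG.mul hz).mul ((differentiableAt_const _).add
    ((differentiableAt_id.sub_const _).mul hp))

lemma halfplane_mem_nhds {a : ℝ} {c : ℂ} (h : a < c.re) : {s : ℂ | a ≤ s.re} ∈ 𝓝 c := by
  have : {s : ℂ | a < s.re} ∈ 𝓝 c :=
    (isOpen_lt continuous_const Complex.continuous_re).mem_nhds h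
  exact Filter.mem_of_superset this fun s (hs : a < s.re) => hs.le

lemma Hf_diff {φ : ℂ → ℂ} {ρ A C₀ : ℝ} (hρ : 0 < ρ) (hC0 : 0 < C₀) (hC1 : C₀ < 1)
    (hφ : ∀ s : ℂ, -C₀ ≤ s.re → DifferentiableAt ℂ φ s) :
    DifferentiableOn ℂ (Hf φ ρ A) {s | 2 - C₀ ≤ s.re} := by
  have hN := Nf_diff (ρ := ρ) (A := A) hC1 hφ
  have h1 := (Complex.differentiableOn_dslope (c := (ρ : ℂ) + 2)
    (halfplane_mem_nhds (a := 2 - C₀) (by simp; linarith))).2 hN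
  have h2 := (Complex.differentiableOn_dslope (c := 2)
    (halfplane_mem_nhds (a := 2 - C₀) (by simp; linarith))).2 hN
  have h3 : DifferentiableOn ℂ (fun s : ℂ => 1 / (s - (ρ + 2) + (ρ + 3))) {s | 2 - C₀ ≤ s.re} := by
    refine (differentiableOn_const _).div (by fun_prop) fun s hs h => ?_
    have hs' : 2 - C₀ ≤ s.re := hs
    have := congrArg Complex.re h
    simp at this
    linarith
  have h4 : DifferentiableOn ℂ (fun s : ℂ => 1 / (s - 2 + (ρ + 3))) {s | 2 - C₀ ≤ s.re} := by
    refine (differentiableOn_const _).div (by fun_prop) fun s hs h => ?_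
    have hs' : 2 - C₀ ≤ s.re := hs
    have := congrArg Complex.re h
    simp at this
    linarith
  exact (((h1.sub h2).const_mul _).add (h3.const_mul _)).add (h4.const_mul _)

lemma Hf_eq {φ Dc : ℂ → ℂ} {ρ A C₀ : ℝ} (hρ : 0 < ρ)
    (hD : ∀ s : ℂ, -C₀ ≤ s.re → s ≠ (ρ : ℂ) → Dc s = (A : ℂ) / (s - (ρ : ℂ)) + φ s)
    {s : ℂ} (hs : 2 - C₀ ≤ s.re) (hs1 : s ≠ ρ + 2) (hs2 : s ≠ 2) :
    Hf φ ρ A s = Complex.Gamma s * riemannZeta (s - 1) * Dc (s - 2)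
      - Nf φ ρ A (ρ + 2) / ρ * (1 / (s - (ρ + 2)) - 1 / (s - (ρ + 2) + (ρ + 3)))
      - (-Nf φ ρ A 2 / ρ) * (1 / (s - 2) - 1 / (s - 2 + (ρ + 3))) := by
  have hρ' : (ρ : ℂ) ≠ 0 := by exact_mod_cast hρ.ne'
  have n1 : s - (ρ + 2) ≠ 0 := sub_ne_zero.2 hs1
  have n2 : s - 2 ≠ 0 := sub_ne_zero.2 hs2
  have hz : riemannZeta (s - 1) = (s - 2)⁻¹ * riemannZeta₁ (s - 1) := by
    rw [riemannZeta_eq_inv_sub_mul (fun h => hs2 (by linear_combination h))]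
    congr 2; ring
  have hd : Dc (s - 2) = A / (s - (ρ + 2)) + φ (s - 2) := by
    rw [hD (s - 2) (by simp only [Complex.sub_re, Complex.re_ofNat]; linarith)
      (fun h => hs1 (by linear_combination h))]
    congr 2; ring
  have hM : Complex.Gamma s * riemannZeta (s - 1) * Dc (s - 2) =
      (1 / ρ) * (Nf φ ρ A s / (s - (ρ + 2)) - Nf φ ρ A s / (s - 2)) := by
    rw [hz, hd, Nf]
    field_simp
    ring
  rw [hM, Hf, dslope_of_ne _ hs1, dslope_of_ne _ hs2, slope_def_field, slope_def_field]
  ring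

lemma kappa_bound {u L : ℂ} (hL : L.im = 0) (hu : u.im ≠ 0) :
    ‖1 / u - 1 / (u + L)‖ * |u.im| ^ 2 ≤ ‖L‖ := by
  have h0 : 0 < |u.im| := abs_pos.2 hu
  have a1 := Complex.abs_im_le_norm u
  have a2 := Complex.abs_im_le_norm (u + L)
  rw [Complex.add_im, hL, add_zero] at a2
  have n1 : u ≠ 0 := fun h => hu (by simp [h])
  have n2 : u + L ≠ 0 := fun h => hu (by have := congrArg Complex.im h; simpa [hL] using this)
  have : 1 / u - 1 / (u + L) = L / (u * (u + L)) := by field_simp; ring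
  rw [this, norm_div, norm_mul, div_mul_eq_mul_div, div_le_iff₀ (by positivity), sq]
  gcongr

lemma Hf_decay {φ Dc : ℂ → ℂ} {ρ A C₀ C₁ : ℝ} (hρ : 0 < ρ) (hC1 : C₀ < 1)
    (hD : ∀ s : ℂ, -C₀ ≤ s.re → s ≠ (ρ : ℂ) → Dc s = (A : ℂ) / (s - (ρ : ℂ)) + φ s)
    (h2 : M2 C₀ C₁ Dc) (c : ℝ) :
    ∃ K Y : ℝ, ∀ s : ℂ, 2 - C₀ ≤ s.re → s.re ≤ c → Y ≤ |s.im| →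
      ‖Hf φ ρ A s‖ * |s.im| ^ 2 ≤ K := by
  obtain ⟨hC₁, K2, y0, hK2⟩ := h2
  obtain ⟨n, hn⟩ := exists_nat_ge C₁
  obtain ⟨K1, hK1⟩ := Gamma_zeta_decay (n + 2) (a := 2 - C₀) (b := c) (by linarith)
  set R1 := Nf φ ρ A (ρ + 2) / ρ
  set R2 := -Nf φ ρ A 2 / ρ
  refine ⟨K1 * |K2| + ‖R1‖ * ‖(ρ : ℂ) + 3‖ + ‖R2‖ * ‖(ρ : ℂ) + 3‖, max 1 y0, fun s hs hsc hY => ?_⟩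
  have hY1 : 1 ≤ |s.im| := (le_max_left _ _).trans hY
  have hY2 : y0 ≤ |s.im| := (le_max_right _ _).trans hY
  have him : s.im ≠ 0 := fun h => by rw [h, abs_zero] at hY1; linarith
  have hs1 : s ≠ ρ + 2 := fun h => him (by simp [h])
  have hs2 : s ≠ 2 := fun h => him (by simp [h])
  rw [Hf_eq hρ hD hs hs1 hs2]
  have i1 : (s - (ρ + 2)).im = s.im := by simp
  have i2 : (s - 2).im = s.im := by simp
  have iL : ((ρ : ℂ) + 3).im = 0 := by simp
  have k1 := kappa_bound (u := s - (ρ + 2)) iL (by rw [i1]; exact him)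
  have k2 := kappa_bound (u := s - 2) iL (by rw [i2]; exact him)
  rw [i1] at k1
  rw [i2] at k2
  have hd : ‖Dc (s - 2)‖ ≤ |K2| * |s.im| ^ n := by
    have := hK2 (s - 2) (by simp only [Complex.sub_re, Complex.re_ofNat]; linarith)
      (by rw [i2]; exact hY2)
    rw [i2] at this
    refine this.trans ?_
    have e : |s.im| ^ C₁ ≤ |s.im| ^ n := by
      rw [← Real.rpow_natCast]; exact Real.rpow_le_rpow_of_exponent_le hY1 hn
    have e0 : 0 ≤ |s.im| ^ C₁ := by positivity
    exact mul_le_mul (le_abs_self _) e e0 (abs_nonneg _)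
  have hg := hK1 s hs hsc hY1
  set G := Complex.Gamma s * riemannZeta (s - 1)
  set κ1 := 1 / (s - (ρ + 2)) - 1 / (s - (ρ + 2) + ((ρ : ℂ) + 3))
  set κ2 := 1 / (s - 2) - 1 / (s - 2 + ((ρ : ℂ) + 3))
  have t1 : ‖G * Dc (s - 2) - R1 * κ1 - R2 * κ2‖ ≤ ‖G‖ * ‖Dc (s - 2)‖ + ‖R1‖ * ‖κ1‖ + ‖R2‖ * ‖κ2‖ := by
    refine (norm_sub_le _ _).trans ?_
    rw [norm_mul R2]
    gcongr
    refine (norm_sub_le _ _).trans ?_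
    rw [norm_mul G, norm_mul R1]
  have t2 : ‖G‖ * ‖Dc (s - 2)‖ * |s.im| ^ 2 ≤ K1 * |K2| := by
    calc ‖G‖ * ‖Dc (s - 2)‖ * |s.im| ^ 2 ≤ ‖G‖ * (|K2| * |s.im| ^ n) * |s.im| ^ 2 := by gcongr
      _ = (‖G‖ * |s.im| ^ (n + 2)) * |K2| := by ring
      _ ≤ _ := by gcongr
  calc _ ≤ (‖G‖ * ‖Dc (s - 2)‖ + ‖R1‖ * ‖κ1‖ + ‖R2‖ * ‖κ2‖) * |s.im| ^ 2 := by gcongr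
    _ = ‖G‖ * ‖Dc (s - 2)‖ * |s.im| ^ 2 + ‖R1‖ * (‖κ1‖ * |s.im| ^ 2) + ‖R2‖ * (‖κ2‖ * |s.im| ^ 2) := by ring
    _ ≤ _ := by gcongr

/-- A function on `(0,1]` whose Mellin transform is `1/(s-q) - 1/(s-q+L)`. -/
def kap (q L : ℂ) (t : ℝ) : ℂ :=
  (Set.Ioc (0 : ℝ) 1).indicator (fun t : ℝ => (t : ℂ) ^ (-q)) t -
    (Set.Ioc (0 : ℝ) 1).indicator (fun t : ℝ => (t : ℂ) ^ (-q + L)) t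

lemma kap_mellin {q L s : ℂ} (h : q.re < s.re) (hL : 0 < L.re) :
    HasMellin (kap q L) s (1 / (s - q) - 1 / (s - q + L)) := by
  have e1 := hasMellin_cpow_Ioc (-q) (s := s) (by simp; linarith)
  have e2 := hasMellin_cpow_Ioc (-q + L) (s := s) (by simp; linarith)
  have e3 := hasMellin_sub e1.1 e2.1
  rw [e1.2, e2.2, ← add_assoc, ← sub_eq_add_neg] at e3
  exact e3

lemma kap_continuousAt {q L : ℂ} {x : ℝ} (hx : 0 < x) (hx1 : x < 1) :
    ContinuousAt (kap q L) x := by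
  have h : (fun t : ℝ => (t : ℂ) ^ (-q) - (t : ℂ) ^ (-q + L)) =ᶠ[𝓝 x] kap q L := by
    filter_upwards [Ioo_mem_nhds hx hx1] with t ht
    have : t ∈ Set.Ioc (0 : ℝ) 1 := ⟨ht.1, ht.2.le⟩
    simp only [kap, Set.indicator_of_mem this]
  refine ContinuousAt.congr ?_ h
  exact (Complex.continuousAt_ofReal_cpow_const _ _ (Or.inr hx.ne')).sub
    (Complex.continuousAt_ofReal_cpow_const _ _ (Or.inr hx.ne'))

lemma Gs_asymp {b : ℕ → ℝ} (hb : ∀ k, 0 ≤ b k) {ρ C₀ A C₁ : ℝ} {Dc : ℂ → ℂ}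
    (h1 : M1 b ρ C₀ A Dc) (h2 : M2 C₀ C₁ Dc) : ∃ R1 R2 : ℂ, ∃ C : ℝ,
    R1.re = hMein ρ A * (ρ + 1) ∧ R2 = Dc 0 ∧ ∀ x : ℝ, 0 < x → x < 1 →
      ‖(Gs b x : ℂ) - R1 * kap (ρ + 2) (ρ + 3) x - R2 * kap 2 (ρ + 3) x‖ ≤ C * x ^ (-(2 - C₀)) := by
  have h1' := h1
  obtain ⟨hρ, hC0, hC1, hA, -, -, φ, hφ, hD⟩ := h1'
  have hρ' : (ρ : ℂ) ≠ 0 := by exact_mod_cast hρ.ne'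
  obtain ⟨K, Y, hK⟩ := Hf_decay (φ := φ) hρ hC1 hD h2 (ρ + 4)
  set R1 := Nf φ ρ A (ρ + 2) / ρ with hR1
  set R2 := -Nf φ ρ A 2 / ρ with hR2
  have hHM : ∀ s : ℂ, s.re = ρ + 4 → HasMellin
      (fun x : ℝ => (Gs b x : ℂ) - R1 • kap (ρ + 2) (ρ + 3) x - R2 • kap 2 (ρ + 3) x) s
        (Hf φ ρ A s) := by
    intro s hs
    have g := Gs_mellinConvergent hb h1 (s := s) (by linarith)
    have k1 := kap_mellin (q := ρ + 2) (L := ρ + 3) (s := s) (by simp; linarith) (by simp; linarith)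
    have k2 := kap_mellin (q := 2) (L := ρ + 3) (s := s) (by simp; linarith) (by simp; linarith)
    have m1 := hasMellin_const_smul k1.1 R1
    have m2 := hasMellin_const_smul k2.1 R2
    have m3 := hasMellin_sub g m1.1
    have m4 := hasMellin_sub m3.1 m2.1
    rw [m3.2, m1.2, m2.2, k1.2, k2.2, Gs_mellin hb h1 (by linarith)] at m4
    rw [Hf_eq hρ hD (by linarith) (fun h => by rw [h] at hs; norm_num at hs)
      (fun h => by rw [h] at hs; simp at hs; linarith)]
    exact m4
  obtain ⟨C, hC⟩ := mellin_core (a := 2 - C₀) (c := ρ + 4) (by linarith)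
    (Hf_diff (A := A) hρ hC0 hC1 hφ) hK (hHM _ (by simp)).1
    (fun s hs => (hHM s hs).2)
  refine ⟨R1, R2, C, ?_, ?_, fun x hx hx1 => ?_⟩
  · have e : R1 = ((A * Real.Gamma (ρ + 2) : ℝ) : ℂ) * riemannZeta (ρ + 1) := by
      rw [hR1, Nf, riemannZeta_eq_inv_sub_mul (fun h => hρ' (by linear_combination h))]
      have e1 : (ρ : ℂ) + 2 - 1 = ρ + 1 := by ring
      have e2 : (ρ : ℂ) + 1 - 1 = ρ := by ring
      rw [e1, e2]
      push_cast
      rw [← Complex.Gamma_ofReal]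
      push_cast
      field_simp
      ring
    rw [e, Complex.re_ofReal_mul, hMein, show ρ + 2 = (ρ + 1) + 1 by ring,
      Real.Gamma_add_one (by linarith)]
    ring
  · have hz := hD 0 (by simp; linarith) (fun h => hρ' h.symm)
    rw [hR2, Nf, hz, show (2 : ℂ) - 1 = 1 by norm_num, riemannZeta₁_one, sub_self,
      show (2 : ℂ) = 1 + 1 by norm_num, Complex.Gamma_add_one _ one_ne_zero, Complex.Gamma_one]
    field_simp
    ring
  · refine hC x hx ?_
    exact ((Complex.continuous_ofReal.continuousAt.comp (Gs_continuousAt hb h1 x hx)).sub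
      ((kap_continuousAt hx hx1).const_smul R1)).sub ((kap_continuousAt hx hx1).const_smul R2)

lemma kap_real {q L x : ℝ} (hx : 0 < x) (hx1 : x < 1) :
    kap (q : ℂ) (L : ℂ) x = ((x ^ (-q) - x ^ (-q + L) : ℝ) : ℂ) := by
  have : x ∈ Set.Ioc (0 : ℝ) 1 := ⟨hx, hx1.le⟩
  simp only [kap, Set.indicator_of_mem this]
  push_cast
  rw [Complex.ofReal_cpow hx.le, Complex.ofReal_cpow hx.le]
  push_cast
  rfl

lemma Gs_asymp_real {b : ℕ → ℝ} (hb : ∀ k, 0 ≤ b k) {ρ C₀ A C₁ : ℝ} {Dc : ℂ → ℂ}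
    (h1 : M1 b ρ C₀ A Dc) (h2 : M2 C₀ C₁ Dc) : ∃ C : ℝ, ∀ x : ℝ, 0 < x → x < 1 →
      |Gs b x - (hMein ρ A * (ρ + 1) * x ^ (-ρ - 2) + (Dc 0).re * x ^ (-2 : ℝ))| ≤
        C * x ^ (C₀ - 2) := by
  obtain ⟨hρ, hC0, hC1, -⟩ := id h1
  obtain ⟨R1, R2, C, hR1, hR2, hC⟩ := Gs_asymp hb h1 h2
  refine ⟨C + |R1.re| + |R2.re|, fun x hx hx1 => ?_⟩
  have k1 := kap_real (q := ρ + 2) (L := ρ + 3) hx hx1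
  have k2 := kap_real (q := 2) (L := ρ + 3) hx hx1
  push_cast at k1 k2
  have h := (Complex.abs_re_le_norm _).trans (hC x hx hx1)
  have k1' : kap (ρ + 2) (ρ + 3) x = ((x ^ (-(ρ + 2)) - x ^ (-(ρ + 2) + (ρ + 3)) : ℝ) : ℂ) := by
    rw [k1]; push_cast; rfl
  have k2' : kap 2 (ρ + 3) x = ((x ^ (-2 : ℝ) - x ^ (-2 + (ρ + 3)) : ℝ) : ℂ) := by
    rw [k2]; push_cast; rfl
  rw [k1', k2', Complex.sub_re, Complex.sub_re, Complex.re_mul_ofReal, Complex.re_mul_ofReal,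
    Complex.ofReal_re] at h
  have u1 : x ^ (-(ρ + 2) + (ρ + 3)) ≤ 1 := Real.rpow_le_one hx.le hx1.le (by linarith)
  have u2 : x ^ (-2 + (ρ + 3)) ≤ 1 := Real.rpow_le_one hx.le hx1.le (by linarith)
  have u3 : 1 ≤ x ^ (C₀ - 2) :=
    Real.one_le_rpow_of_pos_of_le_one_of_nonpos hx hx1.le (by linarith)
  have v1 : 0 ≤ x ^ (-(ρ + 2) + (ρ + 3)) := by positivity
  have v2 : 0 ≤ x ^ (-2 + (ρ + 3)) := by positivity
  rw [← hR1, ← hR2, show -ρ - 2 = -(ρ + 2) by ring]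
  rw [show -(2 - C₀) = C₀ - 2 by ring] at h
  set y1 := x ^ (-(ρ + 2) + (ρ + 3))
  set y2 := x ^ (-2 + (ρ + 3))
  set z := x ^ (C₀ - 2)
  have w1 : |R1.re * y1| ≤ |R1.re| * z := by
    rw [abs_mul, abs_of_nonneg v1]; gcongr; linarith
  have w2 : |R2.re * y2| ≤ |R2.re| * z := by
    rw [abs_mul, abs_of_nonneg v2]; gcongr; linarith
  rw [abs_le] at h w1 w2 ⊢
  constructor <;> nlinarith

lemma Gs_order {b : ℕ → ℝ} (hb : ∀ k, 0 ≤ b k) {ρ C₀ A C₁ : ℝ} {Dc : ℂ → ℂ}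
    (h1 : M1 b ρ C₀ A Dc) (h2 : M2 C₀ C₁ Dc) : ∃ C : ℝ, ∀ x : ℝ, 0 < x → x < 1 →
      Gs b x ≤ C * x ^ (-ρ - 2) := by
  obtain ⟨hρ, hC0, hC1, -⟩ := id h1
  obtain ⟨C, hC⟩ := Gs_asymp_real hb h1 h2
  refine ⟨|C| + |hMein ρ A * (ρ + 1)| + |(Dc 0).re|, fun x hx hx1 => ?_⟩
  have h := (abs_le.1 (hC x hx hx1)).2
  have e1 : x ^ (-2 : ℝ) ≤ x ^ (-ρ - 2) :=
    Real.rpow_le_rpow_of_exponent_ge hx hx1.le (by linarith)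
  have e2 : x ^ (C₀ - 2) ≤ x ^ (-ρ - 2) :=
    Real.rpow_le_rpow_of_exponent_ge hx hx1.le (by linarith)
  have f1 : C * x ^ (C₀ - 2) ≤ |C| * x ^ (-ρ - 2) :=
    mul_le_mul (le_abs_self _) e2 (by positivity) (abs_nonneg _)
  have f2 : (Dc 0).re * x ^ (-2 : ℝ) ≤ |(Dc 0).re| * x ^ (-ρ - 2) :=
    mul_le_mul (le_abs_self _) e1 (by positivity) (abs_nonneg _)
  have f3 : hMein ρ A * (ρ + 1) * x ^ (-ρ - 2) ≤ |hMein ρ A * (ρ + 1)| * x ^ (-ρ - 2) :=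
    mul_le_mul_of_nonneg_right (le_abs_self _) (by positivity)
  linarith

theorem statement3    (b : ℕ → ℝ) (hb : ∀ k, 0 ≤ b k) (ρ C₀ A C₁ : ℝ) (Dc : ℂ → ℂ)
    (h1 : M1 b ρ C₀ A Dc) (h2 : M2 C₀ C₁ Dc) :
    ((fun α : ℝ => Bbf b (Real.exp (-α)) -
        (hMein ρ A * (ρ + 1) * α ^ (-ρ - 2) + (Dc 0).re * α ^ (-2 : ℝ)))
      =O[𝓝[>] (0 : ℝ)] fun α : ℝ => α ^ (C₀ - 2)) ∧
    ((fun α : ℝ => iteratedDeriv 3 (Fb b) (Real.exp (-α)))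
      =O[𝓝[>] (0 : ℝ)] fun α : ℝ => α ^ (-ρ - 3)) := by
  have hev : ∀ᶠ α : ℝ in 𝓝[>] (0 : ℝ), 0 < α ∧ α < 1 := Ioo_mem_nhdsGT one_pos
  obtain ⟨C, hC⟩ := Gs_asymp_real hb h1 h2
  obtain ⟨C', hC'⟩ := Gs_order hb h1 h2
  constructor
  · refine IsBigO.of_bound C (hev.mono fun α hα => ?_)
    have h0 := hα.1
    rw [Bbf_eq hb h1 α h0, Real.norm_eq_abs, Real.norm_of_nonneg (by positivity)]
    exact hC α h0 hα.2
  · refine IsBigO.of_bound (Real.exp 3 * 2 * (C' * (1 / 2 : ℝ) ^ (-ρ - 2)))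
      (hev.mono fun α hα => ?_)
    have h0 := hα.1
    have hg := hC' (α / 2) (by linarith) (by linarith [hα.2])
    have hg0 := Gs_nonneg hb (α / 2)
    have hE : Real.exp (3 * α) ≤ Real.exp 3 := Real.exp_le_exp.2 (by linarith [hα.2])
    rw [show α / 2 = 1 / 2 * α by ring, Real.mul_rpow (by norm_num) h0.le] at hg
    rw [show α / 2 = 1 / 2 * α by ring] at hg0
    rw [Real.norm_eq_abs, Real.norm_of_nonneg (by positivity)]
    have e : α ^ (-ρ - 3) = α ^ (-ρ - 2) / α := by
      rw [show -ρ - 3 = -ρ - 2 - 1 by ring, Real.rpow_sub_one h0.ne']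
    calc _ ≤ Real.exp (3 * α) * (2 / α) * Gs b (α / 2) := third_bound hb h1 α h0
      _ = Real.exp (3 * α) * (2 / α) * Gs b (1 / 2 * α) := by
        rw [show α / 2 = 1 / 2 * α by ring]
      _ ≤ Real.exp 3 * (2 / α) * (C' * ((1 / 2 : ℝ) ^ (-ρ - 2) * α ^ (-ρ - 2))) := by gcongr
      _ = _ := by rw [e]; ring
end
end

section
/- Assume the weight sequence b satisfies conditions (M1) and (M2), let α_n be the unique positive solution of 𝒜_b(e^{−α}) = n, and let δ_n = α_n^{1+ρ/3}/ω(n) where ω(n) → ∞ arbitrarily slowly. Then e^{−iθn} · f_b(e^{−α_n+iθ}) / f_b(e^{−α_n}) = e^{−θ² ℬ_b(e^{−α_n})/2} · (1 + O(1/ω³(n))) as n → ∞, uniformly for |θ| ≤ δ_n; i.e. sup_{|θ|≤δ_n} | e^{−iθn} e^{θ²ℬ_b(e^{−α_n})/2} f_b(e^{−α_n+iθ})/f_b(e^{−α_n}) − 1 | = O(1/ω³(n)). -/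
open Filter Topology Asymptotics MeasureTheory Real

noncomputable section

/-- Laplace transform of `e^{itu}` at `1`. -/
lemma aux_int_exp (ε u : ℝ) (hε : 0 < ε) :
    ∫ t in Set.Ioi (0:ℝ), Complex.exp ((-ε + u * Complex.I : ℂ) * t) =
      1 / (ε - u * Complex.I : ℂ) := by
  rw [integral_exp_mul_complex_Ioi (by simp [hε])]
  have h : (ε - u * Complex.I : ℂ) ≠ 0 := by
    intro h; have := congrArg Complex.re h; simp at this; exact hε.ne' this
  have h' : (-ε + u * Complex.I : ℂ) ≠ 0 := by
    intro h; have := congrArg Complex.re h; simp at this; exact hε.ne' this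
  simp
  field_simp
  ring

lemma aux_re (u : ℝ) : (1 / (((1:ℝ):ℂ) - u * Complex.I : ℂ)).re = (1 + u ^ 2)⁻¹ := by
  simp [Complex.normSq_apply]
  ring

/-- contribution of the pole. -/
lemma aux_pole (ε y : ℝ) (hε : 0 < ε) :
    (∫ t in Set.Ioi (0:ℝ), Complex.exp ((-(1:ℝ) + (-y : ℝ) * Complex.I : ℂ) * t) *
      (1 / (ε - t * Complex.I : ℂ))).re ≤ π := by
  have h1 : ∫ t in Set.Ioi (0:ℝ), Complex.exp ((-(1:ℝ) + (-y : ℝ) * Complex.I : ℂ) * t) *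
      (1 / (ε - t * Complex.I : ℂ)) =
      ∫ t in Set.Ioi (0:ℝ), ∫ u in Set.Ioi (0:ℝ),
        Complex.exp ((-(1:ℝ) + (-y : ℝ) * Complex.I : ℂ) * t) *
        Complex.exp ((-ε + t * Complex.I : ℂ) * u) := by
    congr 1; ext t
    rw [integral_const_mul, aux_int_exp ε t hε]
  rw [h1, integral_integral_swap]
  · have h2 : ∀ u : ℝ, ∫ t in Set.Ioi (0:ℝ),
        Complex.exp ((-(1:ℝ) + (-y : ℝ) * Complex.I : ℂ) * t) *
        Complex.exp ((-ε + t * Complex.I : ℂ) * u) =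
        Complex.exp (((-ε * u : ℝ) : ℂ)) * (1 / (((1:ℝ):ℂ) - (u - y : ℝ) * Complex.I : ℂ)) := by
      intro u
      rw [← aux_int_exp 1 (u - y) one_pos, ← integral_const_mul]
      congr 1; ext t
      rw [← Complex.exp_add, ← Complex.exp_add]
      congr 1; push_cast; ring
    simp_rw [h2]
    have hb : ∀ u : ℝ, (Complex.exp (((-ε * u : ℝ) : ℂ)) *
        (1 / (((1:ℝ):ℂ) - (u - y : ℝ) * Complex.I : ℂ))).re =
        Real.exp (-ε * u) * (1 + (u - y) ^ 2)⁻¹ := by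
      intro u
      rw [← Complex.ofReal_exp, Complex.re_ofReal_mul, aux_re]
    have hint : Integrable (fun u : ℝ => (1 + (u - y) ^ 2)⁻¹) :=
      integrable_inv_one_add_sq.comp_sub_right y
    by_cases hI : Integrable (fun u : ℝ => Complex.exp (((-ε * u : ℝ) : ℂ)) *
        (1 / (((1:ℝ):ℂ) - (u - y : ℝ) * Complex.I : ℂ))) (volume.restrict (Set.Ioi (0:ℝ)))
    · have h3 := integral_re hI
      simp only [RCLike.re_eq_complex_re] at h3
      rw [← h3]
      simp_rw [hb]
      calc _ ≤ ∫ u in Set.Ioi (0:ℝ), (1 + (u - y) ^ 2)⁻¹ := by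
            apply setIntegral_mono_on₀
            · have := hI.re
              refine this.congr ?_
              filter_upwards with u using hb u
            · exact hint.integrableOn
            · exact nullMeasurableSet_Ioi
            · intro u hu
              have hu : 0 < u := hu
              have : Real.exp (-ε * u) ≤ 1 := Real.exp_le_one_iff.2 (by nlinarith)
              have h0 : 0 ≤ (1 + (u - y) ^ 2)⁻¹ := by positivity
              nlinarith
        _ ≤ ∫ u : ℝ, (1 + (u - y) ^ 2)⁻¹ :=
            setIntegral_le_integral hint (by filter_upwards with u; positivity)
        _ = π := by
            rw [integral_sub_right_eq_self (fun u : ℝ => (1 + u ^ 2)⁻¹) y]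
            exact integral_univ_inv_one_add_sq
    · rw [integral_undef hI]; simp [pi_pos.le]
  · have hg : Integrable (fun z : ℝ × ℝ => Real.exp (-1 * z.1) * Real.exp (-ε * z.2))
        ((volume.restrict (Set.Ioi (0:ℝ))).prod (volume.restrict (Set.Ioi (0:ℝ)))) :=
      Integrable.mul_prod (integrableOn_exp_mul_Ioi (by norm_num) 0)
        (integrableOn_exp_mul_Ioi (by linarith) 0)
    refine hg.mono' ?_ ?_
    · apply Continuous.aestronglyMeasurable
      unfold Function.uncurry
      fun_prop
    · filter_upwards with z
      simp only [Function.uncurry, norm_mul, Complex.norm_exp]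
      simp

/-- polynomial bound for the regular part. -/
lemma aux_phi (ρ C₀ A C₁ : ℝ) (Dc φ : ℂ → ℂ) (hρ : 0 < ρ) (hC₀ : 0 < C₀)
    (hφ : ∀ s : ℂ, -C₀ ≤ s.re → DifferentiableAt ℂ φ s)
    (hD : ∀ s : ℂ, -C₀ ≤ s.re → s ≠ (ρ : ℂ) → Dc s = (A : ℂ) / (s - (ρ : ℂ)) + φ s)
    (h2 : M2 C₀ C₁ Dc) :
    ∃ M, 0 ≤ M ∧ ∀ ε t : ℝ, 0 ≤ ε → ε ≤ 1 → 0 ≤ t →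
      ‖φ (ρ + ε - t * Complex.I)‖ ≤ M * (1 + t ^ C₁) := by
  obtain ⟨hC₁, K, y₀, hK⟩ := h2
  set Y := max y₀ 1 with hY
  have hcont : ContinuousOn (fun p : ℝ × ℝ => φ (ρ + p.1 - p.2 * Complex.I))
      (Set.Icc 0 1 ×ˢ Set.Icc 0 Y) := by
    intro p hp
    apply ContinuousAt.continuousWithinAt
    have h := (hφ (ρ + p.1 - p.2 * Complex.I) (by
      simp; have := hp.1.1; linarith)).continuousAt
    exact ContinuousAt.comp (f := fun p : ℝ × ℝ => (ρ + p.1 - p.2 * Complex.I : ℂ)) (g := φ) h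
      (by fun_prop)
  obtain ⟨B, hB⟩ := (isCompact_Icc.prod isCompact_Icc).exists_bound_of_continuousOn hcont
  refine ⟨|B| + |K| + |A|, by positivity, ?_⟩
  intro ε t hε hε1 ht
  have htC : 0 ≤ t ^ C₁ := by positivity
  by_cases htY : t ≤ Y
  · have := hB (ε, t) ⟨⟨hε, hε1⟩, ⟨ht, htY⟩⟩
    have h3 := le_abs_self B
    have := abs_nonneg K
    have := abs_nonneg A
    have := abs_nonneg B
    simp only at *
    nlinarith [mul_nonneg (abs_nonneg B) htC, mul_nonneg (abs_nonneg K) htC,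
      mul_nonneg (abs_nonneg A) htC]
  · push Not at htY
    have ht1 : 1 < t := lt_of_le_of_lt (le_max_right _ _) htY
    have hty : y₀ ≤ t := (le_max_left _ _).trans htY.le
    set s : ℂ := ρ + ε - t * Complex.I with hs
    have hre : s.re = ρ + ε := by simp [hs]
    have him : s.im = -t := by simp [hs]
    have hsre : -C₀ ≤ s.re := by rw [hre]; linarith
    have hne : s ≠ ρ := by
      intro h; have := congrArg Complex.im h; rw [him] at this; simp at this; linarith
    have h3 := hD s hsre hne
    have h4 := hK s hsre (by rw [him, abs_neg, abs_of_nonneg ht]; exact hty)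
    rw [him, abs_neg, abs_of_nonneg ht] at h4
    have h5 : φ s = Dc s - A / (s - ρ) := by rw [h3]; ring
    have h6 : 1 ≤ ‖s - ρ‖ := by
      have := Complex.abs_im_le_norm (s - ρ)
      simp only [Complex.sub_im, him, Complex.ofReal_im, sub_zero, abs_neg, abs_of_nonneg ht] at this
      linarith
    have h7 : ‖(A : ℂ) / (s - ρ)‖ ≤ |A| := by
      rw [norm_div, Complex.norm_real, Real.norm_eq_abs]
      exact div_le_self (abs_nonneg _) h6
    have h8 : ‖φ s‖ ≤ K * t ^ C₁ + |A| := by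
      rw [h5]; exact (norm_sub_le _ _).trans (add_le_add h4 h7)
    have := mul_le_mul_of_nonneg_right (le_abs_self K) htC
    nlinarith [mul_nonneg (abs_nonneg B) htC, mul_nonneg (abs_nonneg K) htC,
      mul_nonneg (abs_nonneg A) htC, abs_nonneg A, abs_nonneg B, abs_nonneg K]

lemma aux_key_eps (b : ℕ → ℝ) (hb : ∀ k, 0 ≤ b k) (ρ C₀ A C₁ : ℝ) (Dc : ℂ → ℂ)
    (h1 : M1 b ρ C₀ A Dc) (h2 : M2 C₀ C₁ Dc) :
    ∃ C : ℝ, ∀ ε y : ℝ, 0 < ε → ε ≤ 1 → ∀ S : Finset ℕ,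
      ∑ k ∈ S, b (k + 1) * ((k : ℝ) + 1) ^ (-(ρ + ε)) * (1 + (Real.log ((k : ℝ) + 1) - y) ^ 2)⁻¹
        ≤ C := by
  obtain ⟨hρ, hC₀, hC₀1, hA, hsum, hdiff, φ, hφ, hD⟩ := h1
  obtain ⟨M, hM, hφM⟩ := aux_phi ρ C₀ A C₁ Dc φ hρ hC₀ hφ hD h2
  have hC₁ : 0 < C₁ := h2.1
  have hGint : IntegrableOn (fun t : ℝ => Real.exp (-t) * (M * (1 + t ^ C₁))) (Set.Ioi 0) := by
    have g1 := Real.GammaIntegral_convergent (s := 1) one_pos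
    have g2 := Real.GammaIntegral_convergent (s := C₁ + 1) (by linarith)
    have := (g1.add g2).const_mul M
    refine this.congr ?_
    filter_upwards with t
    simp
    ring
  refine ⟨A * π + ∫ t in Set.Ioi (0:ℝ), Real.exp (-t) * (M * (1 + t ^ C₁)), ?_⟩
  intro ε y hε hε1 S
  set a : ℕ → ℝ := fun k => b (k + 1) * ((k : ℝ) + 1) ^ (-(ρ + ε)) with ha
  have ha0 : ∀ k, 0 ≤ a k := fun k => mul_nonneg (hb _) (by positivity)
  have hs : ∀ t : ℝ, HasSum (fun k : ℕ => (a k : ℂ) *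
      Complex.exp (t * Real.log ((k : ℝ) + 1) * Complex.I)) (Dc (ρ + ε - t * Complex.I)) := by
    intro t
    convert hsum (ρ + ε - t * Complex.I) (by simp [hε]) using 2 with k
    have hk : ((k + 1 : ℕ) : ℂ) ≠ 0 := by exact_mod_cast Nat.succ_ne_zero k
    have hk' : (0:ℝ) < (k:ℝ) + 1 := by positivity
    rw [Complex.cpow_def_of_ne_zero hk, ha]
    simp only
    rw [Real.rpow_def_of_pos hk']
    push_cast
    rw [mul_assoc, ← Complex.exp_add]
    have : Complex.log ((k:ℂ) + 1) = (Real.log ((k:ℝ)+1) : ℂ) := by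
      rw [Complex.ofReal_log hk'.le]; push_cast; rfl
    rw [this]
    congr 2
    ring
  have hsa : Summable a := by
    have := (hs 0).summable
    simp only [Complex.ofReal_zero, zero_mul, Complex.exp_zero, mul_one] at this
    exact_mod_cast this
  -- the family
  set u : ℕ → ℝ := fun k => Real.log ((k : ℝ) + 1) - y with hu
  set G : ℕ → ℝ → ℂ := fun k t => (a k : ℂ) * Complex.exp ((-(1:ℝ) + u k * Complex.I : ℂ) * t)
    with hG
  have hGi : ∀ k, Integrable (G k) (volume.restrict (Set.Ioi (0:ℝ))) := fun k =>
    Integrable.const_mul (integrableOn_exp_mul_complex_Ioi (by simp) 0) _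
  have hGn : ∀ k t, ‖G k t‖ = a k * Real.exp (-t) := by
    intro k t
    simp [hG, Complex.norm_exp, abs_of_nonneg (ha0 k)]
  have hsumG : Summable fun k => ∫ t in Set.Ioi (0:ℝ), ‖G k t‖ := by
    simp_rw [hGn, integral_const_mul]
    exact hsa.mul_right _
  have hH := hasSum_integral_of_summable_integral_norm hGi hsumG
  have hGI : ∀ k, ∫ t in Set.Ioi (0:ℝ), G k t = (a k : ℂ) * (1 / (((1:ℝ):ℂ) - u k * Complex.I)) := by
    intro k
    simp only [hG]
    rw [integral_const_mul, aux_int_exp 1 (u k) one_pos]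
  simp_rw [hGI] at hH
  set E : ℝ → ℂ := fun t => Complex.exp ((-(1:ℝ) + (-y : ℝ) * Complex.I : ℂ) * t) with hE
  have hEn : ∀ t, ‖E t‖ = Real.exp (-t) := by
    intro t; simp [hE, Complex.norm_exp]
  have hEi : Integrable E (volume.restrict (Set.Ioi (0:ℝ))) :=
    integrableOn_exp_mul_complex_Ioi (by simp) 0
  have hts : ∀ t, ∑' k, G k t = (A : ℂ) * (E t * (1 / (ε - t * Complex.I : ℂ))) +
      E t * φ (ρ + ε - t * Complex.I) := by
    intro t
    have : HasSum (fun k => G k t) (E t * Dc (ρ + ε - t * Complex.I)) := by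
      refine ((hs t).mul_left (E t)).congr_fun ?_
      intro k
      simp only [hG, hE, hu]
      rw [mul_left_comm, ← Complex.exp_add]
      congr 2
      push_cast
      ring
    rw [this.tsum_eq, hD]
    · have : (ρ + ε - t * Complex.I - ρ : ℂ) = ε - t * Complex.I := by ring
      rw [this]; ring
    · simp; linarith
    · intro h; have := congrArg Complex.re h; simp at this; linarith
  have hne : ∀ t : ℝ, (ε - t * Complex.I : ℂ) ≠ 0 := by
    intro t h; have := congrArg Complex.re h; simp at this; linarith
  have hi1 : Integrable (fun t : ℝ => E t * (1 / (ε - t * Complex.I : ℂ)))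
      (volume.restrict (Set.Ioi (0:ℝ))) := by
    refine hEi.mul_bdd (c := 1 / ε) ?_ ?_
    · apply Continuous.aestronglyMeasurable
      exact Continuous.div continuous_const (by fun_prop) hne
    · filter_upwards with t
      rw [norm_div, norm_one]
      have := Complex.abs_re_le_norm (ε - t * Complex.I : ℂ)
      simp only [Complex.sub_re, Complex.ofReal_re, Complex.mul_re, Complex.I_re, mul_zero,
        Complex.ofReal_im, Complex.I_im, mul_one, sub_self, sub_zero, abs_of_pos hε] at this
      exact one_div_le_one_div_of_le hε this
  have hbd : ∀ t ∈ Set.Ioi (0:ℝ), ‖E t * φ (ρ + ε - t * Complex.I)‖ ≤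
      Real.exp (-t) * (M * (1 + t ^ C₁)) := by
    intro t ht
    rw [norm_mul, hEn]
    exact mul_le_mul_of_nonneg_left (hφM ε t hε.le hε1 (le_of_lt ht)) (Real.exp_pos _).le
  have hcφ : Continuous (fun t : ℝ => φ (ρ + ε - t * Complex.I)) := by
    rw [continuous_iff_continuousAt]
    intro t
    have h := (hφ (ρ + ε - t * Complex.I) (by simp; linarith)).continuousAt
    exact ContinuousAt.comp (f := fun t : ℝ => (ρ + ε - t * Complex.I : ℂ)) (g := φ) h
      (by fun_prop)
  have hi2 : Integrable (fun t : ℝ => E t * φ (ρ + ε - t * Complex.I))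
      (volume.restrict (Set.Ioi (0:ℝ))) := by
    refine hGint.mono' ?_ ?_
    · exact (Continuous.mul (by fun_prop) hcφ).aestronglyMeasurable
    · exact (ae_restrict_iff' measurableSet_Ioi).2 (Eventually.of_forall hbd)
  simp_rw [hts] at hH
  rw [integral_add (hi1.const_mul _) hi2, integral_const_mul] at hH
  have hR := Complex.hasSum_re hH
  have hterm : ∀ k, ((a k : ℂ) * (1 / (((1:ℝ):ℂ) - u k * Complex.I))).re =
      a k * (1 + u k ^ 2)⁻¹ := by
    intro k
    rw [Complex.re_ofReal_mul, aux_re]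
  simp_rw [hterm] at hR
  refine (sum_le_hasSum S (fun k _ => mul_nonneg (ha0 k) (by positivity)) hR).trans ?_
  rw [Complex.add_re, Complex.re_ofReal_mul]
  refine add_le_add (mul_le_mul_of_nonneg_left (aux_pole ε y hε) hA.le) ?_
  refine (Complex.re_le_norm _).trans ?_
  exact norm_integral_le_of_norm_le hGint
    ((ae_restrict_iff' measurableSet_Ioi).2 (Eventually.of_forall hbd))

lemma aux_key (b : ℕ → ℝ) (hb : ∀ k, 0 ≤ b k) (ρ C₀ A C₁ : ℝ) (Dc : ℂ → ℂ)
    (h1 : M1 b ρ C₀ A Dc) (h2 : M2 C₀ C₁ Dc) :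
    ∃ C : ℝ, ∀ y : ℝ, ∀ S : Finset ℕ,
      ∑ k ∈ S, b (k + 1) * ((k : ℝ) + 1) ^ (-ρ) * (1 + (Real.log ((k : ℝ) + 1) - y) ^ 2)⁻¹
        ≤ C := by
  obtain ⟨C, hC⟩ := aux_key_eps b hb ρ C₀ A C₁ Dc h1 h2
  refine ⟨C, fun y S => ?_⟩
  have hlim : Tendsto (fun ε : ℝ => ∑ k ∈ S, b (k + 1) * ((k : ℝ) + 1) ^ (-(ρ + ε)) *
      (1 + (Real.log ((k : ℝ) + 1) - y) ^ 2)⁻¹) (𝓝[>] 0)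
      (𝓝 (∑ k ∈ S, b (k + 1) * ((k : ℝ) + 1) ^ (-(ρ + 0)) *
      (1 + (Real.log ((k : ℝ) + 1) - y) ^ 2)⁻¹)) := by
    apply Tendsto.mono_left _ nhdsWithin_le_nhds
    apply Continuous.tendsto (f := fun ε : ℝ => ∑ k ∈ S, b (k + 1) * ((k : ℝ) + 1) ^ (-(ρ + ε)) *
      (1 + (Real.log ((k : ℝ) + 1) - y) ^ 2)⁻¹)
    refine continuous_finsetSum _ fun k _ => ?_
    refine (continuous_const.mul ?_).mul continuous_const
    exact Continuous.rpow continuous_const (by fun_prop) (fun x => Or.inl (by positivity))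
  rw [add_zero] at hlim
  refine le_of_tendsto hlim ?_
  filter_upwards [Ioo_mem_nhdsGT (zero_lt_one' ℝ)] with ε hε
  exact hC ε y hε.1 hε.2.le S

lemma aux_rpow_exp (p x : ℝ) (hp : 0 < p) (hx : 0 < x) :
    x ^ p ≤ (8 * p) ^ p * Real.exp (x / 8) := by
  have h1 : x / (8 * p) ≤ Real.exp (x / (8 * p)) := by
    have := Real.add_one_le_exp (x / (8 * p)); linarith
  have h2 : (x / (8 * p)) ^ p ≤ Real.exp (x / (8 * p)) ^ p :=
    Real.rpow_le_rpow (by positivity) h1 hp.le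
  rw [← Real.exp_mul, Real.div_rpow hx.le (by positivity), div_le_iff₀ (by positivity)] at h2
  have h3 : x / (8 * p) * p = x / 8 := by field_simp
  rw [h3] at h2
  linarith

lemma aux_decay (ρ : ℝ) (hρ : 0 < ρ) :
    ∃ C : ℝ, 0 ≤ C ∧ ∀ x : ℝ, 0 < x →
      Real.exp (-(x / 8)) ≤ C * (x ^ (-ρ) * (1 + (Real.log x) ^ 2)⁻¹) := by
  refine ⟨(8 * ρ) ^ ρ + ((8 * (2 * ρ)) ^ (2 * ρ) + 1) / (ρ ^ 2 / 2), by positivity, ?_⟩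
  intro x hx
  have e1 := aux_rpow_exp ρ x hρ hx
  have e2 := aux_rpow_exp (2 * ρ) x (by linarith) hx
  have e3 : 1 ≤ Real.exp (x / 8) := Real.one_le_exp (by positivity)
  have hxp : 0 < x ^ ρ := by positivity
  have hlog : (Real.log x) ^ 2 * (ρ ^ 2 / 2) ≤ x ^ ρ + (x ^ ρ)⁻¹ := by
    have hq := Real.quadratic_le_exp_of_nonneg (x := |Real.log x * ρ|) (abs_nonneg _)
    rw [sq_abs] at hq
    have ha := Real.add_one_le_exp (-|Real.log x * ρ|)
    have hcosh := Real.cosh_eq (Real.log x * ρ)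
    have hh := Real.cosh_eq |Real.log x * ρ|
    rw [Real.cosh_abs] at hh
    have : x ^ ρ = Real.exp (Real.log x * ρ) := Real.rpow_def_of_pos hx ρ
    rw [this, ← Real.exp_neg]
    nlinarith
  have hmain : x ^ ρ * (1 + (Real.log x) ^ 2) ≤
      ((8 * ρ) ^ ρ + ((8 * (2 * ρ)) ^ (2 * ρ) + 1) / (ρ ^ 2 / 2)) * Real.exp (x / 8) := by
    have h2 : x ^ (2 * ρ) = x ^ ρ * x ^ ρ := by rw [← Real.rpow_add hx]; ring_nf
    have h4 : x ^ ρ * ((Real.log x) ^ 2 * (ρ ^ 2 / 2)) ≤ x ^ (2 * ρ) + 1 := by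
      calc _ ≤ x ^ ρ * (x ^ ρ + (x ^ ρ)⁻¹) := mul_le_mul_of_nonneg_left hlog hxp.le
        _ = _ := by rw [h2]; field_simp
    have h5 : x ^ ρ * (Real.log x) ^ 2 ≤ (x ^ (2 * ρ) + 1) / (ρ ^ 2 / 2) := by
      rw [le_div_iff₀ (by positivity)]; linarith
    have h6 : (x ^ (2 * ρ) + 1) / (ρ ^ 2 / 2) ≤ (((8 * (2 * ρ)) ^ (2 * ρ) + 1) * Real.exp (x / 8)) / (ρ ^ 2 / 2) := by
      gcongr
      nlinarith
    rw [mul_add, mul_one, add_mul]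
    refine add_le_add e1 (h5.trans (h6.trans (le_of_eq (by ring))))
  rw [Real.exp_neg, Real.rpow_neg hx.le, ← mul_inv, ← div_eq_mul_inv, le_div_iff₀ (by positivity),
    inv_mul_le_iff₀ (Real.exp_pos _)]
  linarith

lemma aux_geom (x : ℝ) (hx : 0 < x) :
    Summable (fun j : ℕ => (j : ℝ) ^ 2 * Real.exp (-(x * j))) ∧
    ∑' j : ℕ, (j : ℝ) ^ 2 * Real.exp (-(x * j)) ≤ 64 / x ^ 3 * Real.exp (-(x / 8)) := by
  set q := Real.exp (-(x / 4)) with hq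
  have hq1 : q < 1 := by rw [hq]; have := Real.exp_lt_exp.2 (show -(x/4) < 0 by linarith); rwa [Real.exp_zero] at this
  have hq0 : 0 < q := Real.exp_pos _
  have hgs := hasSum_geometric_of_lt_one hq0.le hq1
  have hgs' := hgs.mul_left (8 / x ^ 2 * q)
  have hle : ∀ j : ℕ, (j : ℝ) ^ 2 * Real.exp (-(x * j)) ≤ 8 / x ^ 2 * q * q ^ j := by
    intro j
    rcases Nat.eq_zero_or_pos j with rfl | hj
    · simp; positivity
    · have hj1 : (1:ℝ) ≤ j := by exact_mod_cast hj
      have h1 := Real.quadratic_le_exp_of_nonneg (x := x * j / 2) (by positivity)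
      have h2 : (j:ℝ) ^ 2 ≤ 8 / x ^ 2 * Real.exp (x * j / 2) := by
        rw [div_mul_eq_mul_div, le_div_iff₀ (by positivity)]
        have : 0 ≤ x * j := by positivity
        nlinarith
      calc (j : ℝ) ^ 2 * Real.exp (-(x * j)) ≤
          8 / x ^ 2 * Real.exp (x * j / 2) * Real.exp (-(x * j)) := by gcongr
        _ = 8 / x ^ 2 * Real.exp (-(x * j / 2)) := by
          rw [mul_assoc, ← Real.exp_add]; congr 2; ring
        _ ≤ 8 / x ^ 2 * (q * q ^ j) := by
          rw [hq, ← Real.exp_nat_mul, ← Real.exp_add]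
          gcongr
          nlinarith
        _ = _ := by ring
  have hsum : Summable (fun j : ℕ => (j : ℝ) ^ 2 * Real.exp (-(x * j))) :=
    Summable.of_nonneg_of_le (fun j => by positivity) hle hgs'.summable
  refine ⟨hsum, (hsum.tsum_le_tsum hle hgs'.summable).trans ?_⟩
  rw [hgs'.tsum_eq]
  have h1 : (1 - q)⁻¹ ≤ (x + 4) / x := by
    rw [inv_le_comm₀ (by linarith) (by positivity), inv_div]
    have h3 := Real.add_one_le_exp (x / 4)
    have h4 : q * Real.exp (x / 4) = 1 := by rw [hq, ← Real.exp_add]; simp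
    rw [div_le_iff₀ (by linarith)]
    nlinarith
  have h2 : x + 4 ≤ 8 * Real.exp (x / 8) := by
    have := Real.add_one_le_exp (x / 8); linarith
  have h5 : q = Real.exp (-(x / 8)) * Real.exp (-(x / 8)) := by
    rw [← Real.exp_add, hq]; congr 1; ring
  have h6 : Real.exp (-(x / 8)) * Real.exp (x / 8) = 1 := by rw [← Real.exp_add]; simp
  calc 8 / x ^ 2 * q * (1 - q)⁻¹ ≤ 8 / x ^ 2 * q * ((8 * Real.exp (x / 8)) / x) := by
        gcongr
        exact h1.trans (by gcongr)
    _ = 64 / x ^ 3 * (Real.exp (-(x / 8)) * (Real.exp (-(x / 8)) * Real.exp (x / 8))) := by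
        rw [h5]; field_simp; norm_num
    _ = _ := by rw [h6, mul_one]

lemma aux_T (b : ℕ → ℝ) (hb : ∀ k, 0 ≤ b k) (ρ C₀ A C₁ : ℝ) (Dc : ℂ → ℂ)
    (h1 : M1 b ρ C₀ A Dc) (h2 : M2 C₀ C₁ Dc) :
    ∃ C : ℝ, ∀ α : ℝ, 0 < α →
      Summable (fun p : ℕ × ℕ => b (p.1 + 1) / (p.2 : ℝ) * (((p.1 + 1) * p.2 : ℕ) : ℝ) ^ 3 *
        Real.exp (-α) ^ ((p.1 + 1) * p.2)) ∧
      ∑' p : ℕ × ℕ, b (p.1 + 1) / (p.2 : ℝ) * (((p.1 + 1) * p.2 : ℕ) : ℝ) ^ 3 *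
        Real.exp (-α) ^ ((p.1 + 1) * p.2) ≤ C * α ^ (-(3 + ρ)) := by
  obtain ⟨C, hC⟩ := aux_key b hb ρ C₀ A C₁ Dc h1 h2
  have hρ := h1.1
  obtain ⟨C', hC'0, hC'⟩ := aux_decay ρ hρ
  refine ⟨64 * C' * C, fun α hα => ?_⟩
  set f : ℕ × ℕ → ℝ := fun p => b (p.1 + 1) / (p.2 : ℝ) * (((p.1 + 1) * p.2 : ℕ) : ℝ) ^ 3 *
        Real.exp (-α) ^ ((p.1 + 1) * p.2) with hf
  have hf0 : 0 ≤ f := fun p => by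
    have := hb (p.1 + 1)
    simp only [hf, Pi.zero_apply]; positivity
  have hfe : ∀ k j : ℕ, f (k, j) = b (k + 1) * ((k:ℝ) + 1) ^ 3 *
      ((j:ℝ) ^ 2 * Real.exp (-((((k:ℝ) + 1) * α) * j))) := by
    intro k j
    simp only [hf]
    rw [← Real.exp_nat_mul]
    push_cast
    have : ((k:ℝ) + 1) * j * -α = -((((k:ℝ) + 1) * α) * j) := by ring
    rw [this]
    rcases Nat.eq_zero_or_pos j with rfl | hj
    · simp
    · have : (j:ℝ) ≠ 0 := by positivity
      field_simp
  have hin : ∀ k, Summable fun j => f (k, j) := by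
    intro k
    simp_rw [hfe]
    exact (aux_geom _ (by positivity)).1.mul_left _
  set g : ℕ → ℝ := fun k => b (k + 1) * ((k : ℝ) + 1) ^ (-ρ) *
    (1 + (Real.log ((k : ℝ) + 1) - (-Real.log α)) ^ 2)⁻¹ with hg
  have hg0 : 0 ≤ g := fun k => by
    have := hb (k + 1)
    simp only [hg, Pi.zero_apply]; positivity
  have hgs : Summable g := summable_of_sum_le hg0 (hC (-Real.log α))
  have hgC : ∑' k, g k ≤ C := Real.tsum_le_of_sum_le hg0 (hC (-Real.log α))
  have hle : ∀ k, ∑' j, f (k, j) ≤ (64 * C' * α ^ (-(3 + ρ))) * g k := by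
    intro k
    have hk : (0:ℝ) < (k:ℝ) + 1 := by positivity
    simp_rw [hfe, tsum_mul_left]
    have hbk := hb (k + 1)
    have hx : 0 < ((k:ℝ) + 1) * α := by positivity
    calc _ ≤ b (k + 1) * ((k:ℝ) + 1) ^ 3 * (64 / (((k:ℝ) + 1) * α) ^ 3 *
          (C' * ((((k:ℝ) + 1) * α) ^ (-ρ) * (1 + (Real.log (((k:ℝ) + 1) * α)) ^ 2)⁻¹))) := by
          refine mul_le_mul_of_nonneg_left ?_ (by positivity)
          refine (aux_geom _ hx).2.trans ?_
          exact mul_le_mul_of_nonneg_left (hC' _ hx) (by positivity)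
      _ = _ := by
          have e1 : α ^ (-(3 + ρ)) = (α ^ 3)⁻¹ * α ^ (-ρ) := by
            rw [neg_add, Real.rpow_add hα, Real.rpow_neg hα.le]
            norm_cast
          rw [Real.mul_rpow hk.le hα.le, Real.log_mul hk.ne' hα.ne', e1]
          simp only [hg, sub_neg_eq_add]
          field_simp
  have hs1 : Summable fun k => ∑' j, f (k, j) :=
    Summable.of_nonneg_of_le (fun k => tsum_nonneg fun j => hf0 (k, j)) hle (hgs.mul_left _)
  have hs : Summable f := (summable_prod_of_nonneg hf0).2 ⟨hin, hs1⟩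
  refine ⟨hs, ?_⟩
  rw [hs.tsum_prod' hin]
  refine (hs1.tsum_le_tsum hle (hgs.mul_left _)).trans ?_
  rw [tsum_mul_left]
  calc _ ≤ (64 * C' * α ^ (-(3 + ρ))) * C := mul_le_mul_of_nonneg_left hgC (by positivity)
    _ = _ := by ring

lemma aux_deriv {ι : Type*} (d : ι → ℝ) (N : ι → ℕ) (hd : ∀ i, 0 ≤ d i)
    (hs0 : ∀ r : ℝ, 0 < r → r < 1 → Summable fun i => d i * r ^ N i)
    (hs1 : ∀ r : ℝ, 0 < r → r < 1 → Summable fun i => d i * N i * r ^ N i)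
    (r : ℝ) (hr0 : 0 < r) (hr1 : r < 1) :
    HasDerivAt (fun x => ∑' i, d i * x ^ N i) ((∑' i, d i * N i * r ^ N i) / r) r := by
  have key : ∀ i, ∀ x : ℝ, 0 < x → (d i * (N i * x ^ (N i - 1))) = d i * N i * x ^ N i / x := by
    intro i x hx
    rcases Nat.eq_zero_or_pos (N i) with h | h
    · simp [h]
    · have : x ^ N i = x ^ (N i - 1) * x := by rw [← pow_succ]; congr 1; omega
      rw [this]; field_simp
  set s := (1 + r) / 2 with hs
  have hs0' : 0 < s := by positivity
  have hs1' : s < 1 := by rw [hs]; linarith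
  have hrs : r < s := by rw [hs]; linarith
  have hu : Summable fun i => d i * (N i * s ^ (N i - 1)) := by
    simp_rw [key _ s hs0']
    exact (hs1 s hs0' hs1').div_const s
  have := hasDerivAt_tsum_of_isPreconnected (g := fun i x => d i * x ^ N i)
    (g' := fun i x => d i * (N i * x ^ (N i - 1))) (t := Set.Ioo 0 s) (y₀ := r) (y := r) hu
    isOpen_Ioo isPreconnected_Ioo
    (fun i y _ => (hasDerivAt_pow (N i) y).const_mul (d i))
    (fun i y hy => by
      have h1 := hd i
      have h2 : 0 < y := hy.1
      rw [Real.norm_of_nonneg (by positivity)]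
      gcongr
      exact hy.2.le)
    ⟨hr0, hrs⟩ (hs0 r hr0 hr1) ⟨hr0, hrs⟩
  simp_rw [key _ r hr0, tsum_div_const] at this
  exact this

lemma aux_cubic (w : ℝ) :
    ‖Complex.exp (w * Complex.I) - 1 - w * Complex.I + (w : ℂ) ^ 2 / 2‖ ≤ 4 * |w| ^ 3 := by
  by_cases hw : |w| ≤ 1
  · have h := Complex.norm_exp_sub_sum_le_norm_mul_exp (w * Complex.I) 3
    have hn : ‖(w * Complex.I : ℂ)‖ = |w| := by simp
    rw [hn] at h
    have he : Real.exp |w| ≤ 4 := by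
      have := Real.exp_one_lt_d9
      have := Real.exp_le_exp.2 hw
      linarith
    have hI : (w * Complex.I : ℂ) ^ 2 = -(w:ℂ) ^ 2 := by rw [mul_pow, Complex.I_sq]; ring
    have heq : Complex.exp (w * Complex.I) - 1 - w * Complex.I + (w : ℂ) ^ 2 / 2 =
        Complex.exp (w * Complex.I) - ∑ m ∈ Finset.range 3, (w * Complex.I) ^ m / (m.factorial : ℂ) := by
      simp only [Finset.sum_range_succ, Finset.sum_range_zero, hI]
      simp
      ring
    rw [heq]
    refine h.trans ?_
    rw [mul_comm]
    gcongr
  · push Not at hw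
    have h1 : ‖Complex.exp (w * Complex.I)‖ = 1 := Complex.norm_exp_ofReal_mul_I w
    calc _ ≤ ‖Complex.exp (w * Complex.I)‖ + ‖(1:ℂ)‖ + ‖(w * Complex.I : ℂ)‖ + ‖(w : ℂ) ^ 2 / 2‖ := by
          refine (norm_add_le _ _).trans ?_
          gcongr
          refine (norm_sub_le _ _).trans ?_
          gcongr
          exact norm_sub_le _ _
      _ = 2 + |w| + |w| ^ 2 / 2 := by rw [h1]; simp; norm_num
      _ ≤ _ := by nlinarith [mul_pos (sub_pos.2 hw) (sub_pos.2 hw), pow_pos (sub_pos.2 hw) 3]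

lemma aux_FbC (b : ℕ → ℝ) (hb : ∀ k, 0 ≤ b k) (r : ℝ) (hr0 : 0 < r) (hr1 : r < 1)
    (hs : Summable (fun p : ℕ × ℕ => b (p.1 + 1) / (p.2 : ℝ) * r ^ ((p.1 + 1) * p.2)))
    (z : ℂ) (hz : ‖z‖ = r) :
    HasSum (fun p : ℕ × ℕ => ((b (p.1 + 1) / (p.2 : ℝ) : ℝ) : ℂ) * z ^ ((p.1 + 1) * p.2))
      (FbC b z) := by
  have hsz : Summable (fun p : ℕ × ℕ =>
      ((b (p.1 + 1) / (p.2 : ℝ) : ℝ) : ℂ) * z ^ ((p.1 + 1) * p.2)) := by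
    apply Summable.of_norm
    refine hs.congr fun p => ?_
    have := hb (p.1 + 1)
    rw [norm_mul, norm_pow, hz, Complex.norm_real, Real.norm_of_nonneg (by positivity)]
  have hin : ∀ k : ℕ, HasSum (fun j : ℕ =>
      ((b (k + 1) / (j : ℝ) : ℝ) : ℂ) * z ^ ((k + 1) * j))
      (b (k + 1) * (-Complex.log (1 - z ^ (k + 1)))) := by
    intro k
    have hk : ‖z ^ (k + 1)‖ < 1 := by
      rw [norm_pow, hz]; exact pow_lt_one₀ hr0.le hr1 (Nat.succ_ne_zero k)
    refine ((Complex.hasSum_taylorSeries_neg_log hk).mul_left (b (k + 1) : ℂ)).congr_fun ?_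
    intro j
    rw [pow_mul]
    push_cast
    ring
  have h1 := hsz.hasSum.prod_fiberwise hin
  have h2 : FbC b z = ∑' k : ℕ, (b (k + 1) : ℂ) * (-Complex.log (1 - z ^ (k + 1))) := by
    unfold FbC
    rw [← tsum_neg]
    congr 1; ext k; ring
  rw [h2, h1.tsum_eq]
  exact hsz.hasSum

lemma aux_Fb (b : ℕ → ℝ) (r : ℝ) (hr0 : 0 < r) (hr1 : r < 1) :
    FbC b (r : ℂ) = (Fb b r : ℂ) := by
  unfold FbC Fb
  push_cast
  congr 2; ext k
  rw [Complex.ofReal_log]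
  · push_cast; rfl
  · have := pow_le_one₀ hr0.le hr1.le (n := k + 1); linarith

lemma aux_AB (b : ℕ → ℝ) (c : ℕ × ℕ → ℝ) (N : ℕ × ℕ → ℕ) (hc : ∀ p, 0 ≤ c p)
    (hF : ∀ r : ℝ, 0 < r → r < 1 → Fb b r = ∑' p, c p * r ^ N p)
    (hs0 : ∀ r : ℝ, 0 < r → r < 1 → Summable fun i => c i * r ^ N i)
    (hs1 : ∀ r : ℝ, 0 < r → r < 1 → Summable fun i => c i * N i * r ^ N i)
    (hs2 : ∀ r : ℝ, 0 < r → r < 1 → Summable fun i => c i * N i * N i * r ^ N i)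
    (r : ℝ) (hr0 : 0 < r) (hr1 : r < 1) :
    Abf b r = ∑' p, c p * N p * r ^ N p ∧ Bbf b r = ∑' p, c p * N p * N p * r ^ N p := by
  have hnh : ∀ x : ℝ, 0 < x → x < 1 → ∀ᶠ y in 𝓝 x, 0 < y ∧ y < 1 := fun x h0 h1 =>
    Ioo_mem_nhds h0 h1
  have hd1 : ∀ x : ℝ, 0 < x → x < 1 → deriv (Fb b) x = (∑' p, c p * N p * x ^ N p) / x := by
    intro x h0 h1
    have h := aux_deriv c N hc hs0 hs1 x h0 h1
    apply HasDerivAt.deriv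
    refine h.congr_of_eventuallyEq ?_
    filter_upwards [hnh x h0 h1] with y hy using hF y hy.1 hy.2
  have hA : Abf b r = ∑' p, c p * N p * r ^ N p := by
    unfold Abf
    rw [hd1 r hr0 hr1]
    field_simp
  refine ⟨hA, ?_⟩
  have hG := aux_deriv (fun p => c p * N p) N (fun p => mul_nonneg (hc p) (by positivity))
    hs1 hs2 r hr0 hr1
  have hd2 : HasDerivAt (deriv (Fb b)) _ r :=
    (hG.div (hasDerivAt_id r) hr0.ne').congr_of_eventuallyEq (by
      filter_upwards [hnh r hr0 hr1] with y hy using hd1 y hy.1 hy.2)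
  unfold Bbf
  rw [iteratedDeriv_succ, iteratedDeriv_one, hd2.deriv, hd1 r hr0 hr1]
  simp only [id]
  field_simp
  ring

theorem statement5    (b : ℕ → ℝ) (hb : ∀ k, 0 ≤ b k) (ρ C₀ A C₁ : ℝ) (Dc : ℂ → ℂ)
    (h1 : M1 b ρ C₀ A Dc) (h2 : M2 C₀ C₁ Dc)
    (α : ℕ → ℝ) (hα : ∀ᶠ n : ℕ in atTop, 0 < α n ∧ Abf b (Real.exp (-α n)) = n)
    (ω : ℕ → ℝ) (hωpos : ∀ n, 0 < ω n) (hω : Tendsto ω atTop atTop) :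
    ∃ K : ℝ, ∀ᶠ n : ℕ in atTop, ∀ θ : ℝ, |θ| ≤ α n ^ (1 + ρ / 3) / ω n →
      ‖Complex.exp (-((θ * n : ℝ) : ℂ) * Complex.I) *
          Complex.exp (((θ ^ 2 * Bbf b (Real.exp (-α n)) / 2 : ℝ) : ℂ)) *
          fbC b (Complex.exp (-(α n : ℂ) + (θ : ℂ) * Complex.I)) /
          fbC b (Complex.exp (-(α n : ℂ))) - 1‖ ≤ K / ω n ^ 3 := by
  obtain ⟨C, hC⟩ := aux_T b hb ρ C₀ A C₁ Dc h1 h2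
  set c : ℕ × ℕ → ℝ := fun p => b (p.1 + 1) / (p.2 : ℝ) with hc
  set N : ℕ × ℕ → ℕ := fun p => (p.1 + 1) * p.2 with hN
  have hc0 : ∀ p, 0 ≤ c p := fun p => div_nonneg (hb _) (by positivity)
  have hcN : ∀ p, N p = 0 → c p = 0 := by
    intro p hp
    have : p.2 = 0 := by simpa [hN] using hp
    simp [hc, this]
  have hs3 : ∀ r : ℝ, 0 < r → r < 1 → Summable fun p => c p * (N p : ℝ) ^ 3 * r ^ N p := by
    intro r h0 h1
    have := (hC (-Real.log r) (by have := Real.log_neg h0 h1; linarith)).1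
    rw [neg_neg, Real.exp_log h0] at this
    exact this
  have hN1 : ∀ p, N p = 0 ∨ (1:ℝ) ≤ N p := by
    intro p
    rcases Nat.eq_zero_or_pos (N p) with h | h
    · exact Or.inl h
    · right; exact_mod_cast h
  have hs0 : ∀ r : ℝ, 0 < r → r < 1 → Summable fun p => c p * r ^ N p := by
    intro r h0 h1
    refine Summable.of_nonneg_of_le (fun p => mul_nonneg (hc0 p) (by positivity)) (fun p => ?_)
      (hs3 r h0 h1)
    rcases hN1 p with h | h
    · simp [hcN p h]
    · refine mul_le_mul_of_nonneg_right ?_ (by positivity)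
      exact le_mul_of_one_le_right (hc0 p) (one_le_pow₀ h)
  have hs1 : ∀ r : ℝ, 0 < r → r < 1 → Summable fun p => c p * N p * r ^ N p := by
    intro r h0 h1
    refine Summable.of_nonneg_of_le (fun p => mul_nonneg (mul_nonneg (hc0 p) (by positivity))
      (by positivity)) (fun p => ?_) (hs3 r h0 h1)
    rcases hN1 p with h | h
    · simp [hcN p h]
    · refine mul_le_mul_of_nonneg_right ?_ (by positivity)
      exact mul_le_mul_of_nonneg_left (le_self_pow₀ h (by norm_num)) (hc0 p)
  have hs2 : ∀ r : ℝ, 0 < r → r < 1 → Summable fun p => c p * N p * N p * r ^ N p := by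
    intro r h0 h1
    refine Summable.of_nonneg_of_le (fun p => mul_nonneg (mul_nonneg (mul_nonneg (hc0 p)
      (by positivity)) (by positivity)) (by positivity)) (fun p => ?_) (hs3 r h0 h1)
    rcases hN1 p with h | h
    · simp [hcN p h]
    · refine mul_le_mul_of_nonneg_right ?_ (by positivity)
      rw [mul_assoc, ← sq]
      exact mul_le_mul_of_nonneg_left (pow_le_pow_right₀ h (by norm_num)) (hc0 p)
  have hF : ∀ r : ℝ, 0 < r → r < 1 → Fb b r = ∑' p, c p * r ^ N p := by
    intro r h0 h1
    have h := aux_FbC b hb r h0 h1 (hs0 r h0 h1) (r : ℂ) (by simp [abs_of_pos h0])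
    rw [aux_Fb b r h0 h1] at h
    have h' : HasSum (fun p => c p * r ^ N p) (Fb b r) := by
      rw [← Complex.hasSum_ofReal]
      refine h.congr_fun fun p => ?_
      simp [hc, hN]
    exact h'.tsum_eq.symm
  refine ⟨2 * (4 * C), ?_⟩
  have hωlarge : ∀ᶠ n in atTop, 4 * C / ω n ^ 3 ≤ 1 := by
    filter_upwards [hω.eventually_ge_atTop (max 1 (4 * C))] with n hn
    have hn1 : 1 ≤ ω n := (le_max_left _ _).trans hn
    have hn2 : 4 * C ≤ ω n := (le_max_right _ _).trans hn
    rw [div_le_one (by positivity)]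
    exact hn2.trans (le_self_pow₀ hn1 (by norm_num))
  filter_upwards [hα, hωlarge] with n hn hωn θ hθ
  obtain ⟨hαn, hAn⟩ := hn
  have hω0 := hωpos n
  set r := Real.exp (-α n) with hr
  have hr0 : 0 < r := Real.exp_pos _
  have hr1 : r < 1 := by
    have := Real.exp_lt_exp.2 (show -α n < 0 by linarith)
    rwa [Real.exp_zero] at this
  obtain ⟨hA, hB⟩ := aux_AB b c N hc0 hF hs0 hs1 hs2 r hr0 hr1
  have hzr : Complex.exp (-(α n : ℂ)) = (r : ℂ) := by rw [hr]; push_cast; rfl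
  set z := Complex.exp (-(α n : ℂ) + (θ : ℂ) * Complex.I) with hz
  have hznorm : ‖z‖ = r := by rw [hz, Complex.norm_exp, hr]; simp
  have hzp : ∀ m : ℕ, z ^ m = (r : ℂ) ^ m * Complex.exp (((m * θ : ℝ) : ℂ) * Complex.I) := by
    intro m
    rw [hz, Complex.exp_add, hzr, mul_pow, ← Complex.exp_nat_mul (θ * Complex.I)]
    congr 2; push_cast; ring
  have H1 := aux_FbC b hb r hr0 hr1 (hs0 r hr0 hr1) z hznorm
  have H2 := aux_FbC b hb r hr0 hr1 (hs0 r hr0 hr1) (r : ℂ) (by simp [abs_of_pos hr0])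
  have H3 : HasSum (fun p => ((c p * N p * r ^ N p : ℝ) : ℂ)) ((n : ℝ) : ℂ) := by
    rw [Complex.hasSum_ofReal, ← hAn, hA]; exact (hs1 r hr0 hr1).hasSum
  have H4 : HasSum (fun p => ((c p * N p * N p * r ^ N p : ℝ) : ℂ)) ((Bbf b r : ℝ) : ℂ) := by
    rw [Complex.hasSum_ofReal, hB]; exact (hs2 r hr0 hr1).hasSum
  have H5 := ((H1.sub H2).sub (H3.mul_left ((θ : ℂ) * Complex.I))).add
    (H4.mul_left ((θ : ℂ) ^ 2 / 2))
  set E : ℂ := FbC b z - FbC b r - (θ : ℂ) * Complex.I * ((n : ℝ) : ℂ) +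
    (θ : ℂ) ^ 2 / 2 * ((Bbf b r : ℝ) : ℂ) with hE
  have H6 := (hs3 r hr0 hr1).hasSum.mul_left (4 * |θ| ^ 3)
  have hEn : ‖E‖ ≤ 4 * |θ| ^ 3 * ∑' p, c p * (N p : ℝ) ^ 3 * r ^ N p := by
    rw [← H5.tsum_eq]
    refine tsum_of_norm_bounded H6 fun p => ?_
    have heq : ((b (p.1 + 1) / (p.2 : ℝ) : ℝ) : ℂ) * z ^ ((p.1 + 1) * p.2) -
        ((b (p.1 + 1) / (p.2 : ℝ) : ℝ) : ℂ) * (r : ℂ) ^ ((p.1 + 1) * p.2) -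
        (θ : ℂ) * Complex.I * ((c p * N p * r ^ N p : ℝ) : ℂ) +
        (θ : ℂ) ^ 2 / 2 * ((c p * N p * N p * r ^ N p : ℝ) : ℂ) =
        ((c p * r ^ N p : ℝ) : ℂ) * (Complex.exp (((N p * θ : ℝ) : ℂ) * Complex.I) - 1 -
          ((N p * θ : ℝ) : ℂ) * Complex.I + ((N p * θ : ℝ) : ℂ) ^ 2 / 2) := by
      change (c p : ℂ) * z ^ N p - (c p : ℂ) * (r : ℂ) ^ N p - _ + _ = _
      rw [hzp]
      push_cast
      ring
    rw [heq, norm_mul, Complex.norm_real, Real.norm_of_nonneg (mul_nonneg (hc0 p) (by positivity))]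
    refine (mul_le_mul_of_nonneg_left (aux_cubic _) (mul_nonneg (hc0 p) (by positivity))).trans
      (le_of_eq ?_)
    rw [abs_mul, Nat.abs_cast]
    ring
  have hθ3 : |θ| ^ 3 ≤ α n ^ (3 + ρ) / ω n ^ 3 := by
    calc |θ| ^ 3 ≤ (α n ^ (1 + ρ / 3) / ω n) ^ 3 := pow_le_pow_left₀ (abs_nonneg _) hθ 3
      _ = _ := by
        rw [div_pow, ← Real.rpow_mul_natCast hαn.le]
        congr 2; push_cast; ring
  have hT0 : 0 ≤ ∑' p, c p * (N p : ℝ) ^ 3 * r ^ N p :=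
    tsum_nonneg fun p => mul_nonneg (mul_nonneg (hc0 p) (by positivity)) (by positivity)
  have hEb : ‖E‖ ≤ 4 * C / ω n ^ 3 := by
    refine hEn.trans ?_
    calc _ ≤ 4 * (α n ^ (3 + ρ) / ω n ^ 3) * (C * α n ^ (-(3 + ρ))) := by
          refine mul_le_mul (by linarith) (hC (α n) hαn).2 hT0 (by positivity)
      _ = 4 * C / ω n ^ 3 * (α n ^ (3 + ρ) * α n ^ (-(3 + ρ))) := by ring
      _ = _ := by rw [← Real.rpow_add hαn]; simp
  have hfin : Complex.exp (-((θ * n : ℝ) : ℂ) * Complex.I) *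
          Complex.exp (((θ ^ 2 * Bbf b r / 2 : ℝ) : ℂ)) *
          fbC b z / fbC b (Complex.exp (-(α n : ℂ))) = Complex.exp E := by
    unfold fbC
    rw [hzr, ← Complex.exp_add, ← Complex.exp_add, ← Complex.exp_sub]
    congr 1
    rw [hE]; push_cast; ring
  rw [hfin]
  refine (Complex.norm_exp_sub_one_le (hEb.trans hωn)).trans ?_
  calc 2 * ‖E‖ ≤ 2 * (4 * C / ω n ^ 3) := by linarith
    _ = _ := by ring
end
end
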